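/- arXiv:2207.01644 — 6 statements merged into one kernel-verified Lean document; each statement's English description precedes it below -/
import Mathlib

section
/- Let n ≥ 3, let B be a nondegenerate symmetric bilinear form on ℝⁿ, let U ⊆ ℝⁿ be a nonempty open connected set containing 0, and let ξ : U → ℝⁿ be a smooth conformal Killing vector of B with conformal factor Ψ (i.e., B(Dξ(x)u, v) + B(u, Dξ(x)v) = 2Ψ(x)B(u,v) on U). Then for all x ∈ U: ξ(x) = ξ(0) + Ψ(0)·x + B(a,x)·x − (B(x,x)/2)·a + (Dξ(0) − Ψ(0)·Id)(x), where a := grad_B Ψ(0) is the unique vector with B(a,u) = DΨ(0)(u) for all u. In particular, ω := Ψ(0)·Id − Dξ(0) is B-skew-adjoint and ξ extends to a globally defined conformal Killing vector of the standard quadratic form on ℝⁿ. -/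
open scoped ContDiff

section BilinearAlgebra

variable {E : Type*} [AddCommGroup E] [Module ℝ E] [FiniteDimensional ℝ E]

/-- A nondegenerate symmetric bilinear form has an orthogonal basis of non-isotropic vectors. -/
theorem exists_orthogonal_nonisotropic_basis (B : E →ₗ[ℝ] E →ₗ[ℝ] ℝ)
    (hSymm : ∀ u v, B u v = B v u) (hNondeg : ∀ u, (∀ v, B u v = 0) → u = 0) :
    ∃ b : Module.Basis (Fin (Module.finrank ℝ E)) ℝ E,
      (∀ i j, i ≠ j → B (b i) (b j) = 0) ∧ ∀ i, B (b i) (b i) ≠ 0 := by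
  have : Invertible (2 : ℝ) := invertibleOfNonzero two_ne_zero
  obtain ⟨b, hb⟩ := LinearMap.BilinForm.exists_orthogonal_basis (B := B)
    ⟨fun u v => by simpa using hSymm u v⟩
  exact ⟨b, fun i j hij => hb hij,
    hb.not_isOrtho_basis_self_of_separatingLeft fun u hu => hNondeg u hu⟩

/-- The integrability condition satisfied by the Hessian of a conformal factor forces the
Hessian to vanish in dimension at least three. -/
theorem eq_zero_of_conformal_integrability (B : E →ₗ[ℝ] E →ₗ[ℝ] ℝ)
    (hn : 3 ≤ Module.finrank ℝ E)
    (hSymm : ∀ u v, B u v = B v u) (hNondeg : ∀ u, (∀ v, B u v = 0) → u = 0)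
    (H : E →ₗ[ℝ] E →ₗ[ℝ] ℝ)
    (hH : ∀ w u v z, H w v * B u z - H w z * B u v = H u v * B w z - H u z * B w v) :
    H = 0 := by
  obtain ⟨b, hb, hb0⟩ := exists_orthogonal_nonisotropic_basis B hSymm hNondeg
  have third : ∀ i j : Fin (Module.finrank ℝ E), ∃ k, k ≠ i ∧ k ≠ j := fun i j => by
    obtain ⟨k, hk⟩ := Finset.exists_mem_notMem_of_card_lt_card
      (s := {i, j}) (t := (Finset.univ : Finset (Fin (Module.finrank ℝ E))))
      (by
        have := Finset.card_le_two (a := i) (b := j)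
        rw [Finset.card_univ, Fintype.card_fin]
        omega)
    exact ⟨k, by simpa using hk⟩
  have diag : ∀ i k, k ≠ i →
      H (b i) (b i) * B (b k) (b k) = - (H (b k) (b k) * B (b i) (b i)) := fun i k hk => by
    have h := hH (b i) (b k) (b i) (b k)
    rw [hb k i hk, hb i k hk.symm] at h
    linarith
  refine b.ext fun i => b.ext fun j => ?_
  obtain ⟨k, hki, hkj⟩ := third i j
  rw [LinearMap.zero_apply, LinearMap.zero_apply]
  rcases eq_or_ne i j with rfl | hij
  · obtain ⟨l, hli, hlk⟩ := third i k
    have h₁ := diag i k hki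
    have h₂ := diag i l hli
    have h₃ := diag k l hlk
    have : H (b i) (b i) * (B (b k) (b k) * B (b l) (b l)) = 0 := by
      linear_combination (B (b l) (b l) / 2) * h₁ + (B (b k) (b k) / 2) * h₂
        - (B (b i) (b i) / 2) * h₃
    exact (mul_eq_zero.mp this).resolve_right (mul_ne_zero (hb0 k) (hb0 l))
  · have h := hH (b i) (b k) (b j) (b k)
    rw [hb k j hkj, hb i k hki.symm, hb i j hij] at h
    exact (mul_eq_zero.mp (by linarith : H (b i) (b j) * B (b k) (b k) = 0)).resolve_right (hb0 k)

end BilinearAlgebra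

section ConformalKilling

variable {E : Type*} [NormedAddCommGroup E] [NormedSpace ℝ E]

/-- `ξ` is a conformal Killing vector of `B` on `U`, with conformal factor `Ψ`. -/
def IsConformalKillingOn (B : E →L[ℝ] E →L[ℝ] ℝ) (ξ : E → E) (Ψ : E → ℝ) (U : Set E) : Prop :=
  ∀ x ∈ U, ∀ u v, B (fderiv ℝ ξ x u) v + B u (fderiv ℝ ξ x v) = 2 * Ψ x * B u v

variable {B : E →L[ℝ] E →L[ℝ] ℝ} {ξ : E → E} {Ψ : E → ℝ} {U : Set E}

theorem hasFDerivAt_bilin_apply {F : Type*} [NormedAddCommGroup F] [NormedSpace ℝ F]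
    (B : E →L[ℝ] E →L[ℝ] ℝ) (ev : F →L[ℝ] E) {f : E → F} {x : E}
    (hf : DifferentiableAt ℝ f x) (v : E) :
    HasFDerivAt (fun y => B (ev (f y)) v) ((B.flip v ∘L ev) ∘L fderiv ℝ f x) x :=
  (B.flip v ∘L ev).hasFDerivAt.comp x hf.hasFDerivAt

/-- The conformal factor of a smooth conformal Killing vector is smooth. -/
theorem IsConformalKillingOn.contDiffOn_factor (h : IsConformalKillingOn B ξ Ψ U)
    (hU : IsOpen U) (hSymm : ∀ u v, B u v = B v u) (hξ : ContDiffOn ℝ ∞ ξ U)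
    {q : E} (hq : B q q ≠ 0) : ContDiffOn ℝ ∞ Ψ U := by
  have hD : ContDiffOn ℝ ∞ (fderiv ℝ ξ) U := hξ.fderiv_of_isOpen hU (by simp)
  have : ContDiffOn ℝ ∞ (fun x => (B.flip q) (fderiv ℝ ξ x q) / B q q) U :=
    ((B.flip q).contDiff.comp_contDiffOn (hD.clm_apply contDiffOn_const)).div_const _
  refine this.congr fun x hx => ?_
  have := h x hx q q
  rw [hSymm q] at this
  rw [ContinuousLinearMap.flip_apply, eq_div_iff hq]
  linarith

/-- The second derivative of a conformal Killing vector in terms of its conformal factor. -/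
theorem IsConformalKillingOn.bilin_fderiv_fderiv (h : IsConformalKillingOn B ξ Ψ U)
    (hU : IsOpen U) (hSymm : ∀ u v, B u v = B v u) (hξ : ContDiffOn ℝ ∞ ξ U)
    (hΨ : ContDiffOn ℝ ∞ Ψ U) {x : E} (hx : x ∈ U) (u v w : E) :
    B (fderiv ℝ (fderiv ℝ ξ) x u v) w
      = fderiv ℝ Ψ x u * B v w + fderiv ℝ Ψ x v * B u w - fderiv ℝ Ψ x w * B u v := by
  have hxU : U ∈ nhds x := hU.mem_nhds hx
  have hD : DifferentiableAt ℝ (fderiv ℝ ξ) x :=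
    ((hξ.fderiv_of_isOpen (m := ∞) hU (by simp)).contDiffAt hxU).differentiableAt (by simp)
  have hψ : DifferentiableAt ℝ Ψ x := (hΨ.contDiffAt hxU).differentiableAt (by simp)
  have hsymm : ∀ u v, fderiv ℝ (fderiv ℝ ξ) x u v = fderiv ℝ (fderiv ℝ ξ) x v u :=
    (hξ.contDiffAt hxU).isSymmSndFDerivAt (by
      simpa using WithTop.coe_le_coe.mpr (le_top : (2 : ℕ∞) ≤ ⊤))
  have key : ∀ w u v, B (fderiv ℝ (fderiv ℝ ξ) x w u) v + B (fderiv ℝ (fderiv ℝ ξ) x w v) u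
      = 2 * fderiv ℝ Ψ x w * B u v := fun w u v => by
    have h₁ := (hasFDerivAt_bilin_apply B (ContinuousLinearMap.apply ℝ E u) hD v).add
      (hasFDerivAt_bilin_apply B (ContinuousLinearMap.apply ℝ E v) hD u)
    have h₂ := (hψ.hasFDerivAt.const_mul 2).mul_const (B u v)
    have h₃ := h₁.congr_of_eventuallyEq (f₁ := fun y => 2 * Ψ y * B u v) <| by
      filter_upwards [hxU] with y hy
      have := h y hy u v
      rw [hSymm u] at this
      simpa using this.symm
    have := DFunLike.congr_fun (h₃.unique h₂) w
    simp only [add_apply, ContinuousLinearMap.comp_apply,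
      ContinuousLinearMap.flip_apply, ContinuousLinearMap.apply_apply,
      smul_apply, smul_eq_mul] at this
    linarith
  have h₁ := key u v w
  have h₂ := key v u w
  have h₃ := key w u v
  rw [hsymm v u] at h₂
  rw [hsymm w u, hsymm w v] at h₃
  linarith

/-- The Hessian of the conformal factor vanishes in dimension at least three. -/
theorem IsConformalKillingOn.fderiv_fderiv_factor_eq_zero [FiniteDimensional ℝ E]
    (h : IsConformalKillingOn B ξ Ψ U)
    (hn : 3 ≤ Module.finrank ℝ E)
    (hU : IsOpen U) (hSymm : ∀ u v, B u v = B v u) (hNondeg : ∀ u, (∀ v, B u v = 0) → u = 0)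
    (hξ : ContDiffOn ℝ ∞ ξ U) (hΨ : ContDiffOn ℝ ∞ Ψ U) {x : E} (hx : x ∈ U) :
    fderiv ℝ (fderiv ℝ Ψ) x = 0 := by
  have hxU : U ∈ nhds x := hU.mem_nhds hx
  have hξ' : ContDiffOn ℝ ∞ (fderiv ℝ ξ) U := hξ.fderiv_of_isOpen hU (by simp)
  have hD : DifferentiableAt ℝ (fderiv ℝ (fderiv ℝ ξ)) x :=
    ((hξ'.fderiv_of_isOpen (m := ∞) hU (by simp)).contDiffAt hxU).differentiableAt (by simp)
  have hψ : DifferentiableAt ℝ (fderiv ℝ Ψ) x :=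
    ((hΨ.fderiv_of_isOpen (m := ∞) hU (by simp)).contDiffAt hxU).differentiableAt (by simp)
  have hsymm : ∀ u v, fderiv ℝ (fderiv ℝ (fderiv ℝ ξ)) x u v
      = fderiv ℝ (fderiv ℝ (fderiv ℝ ξ)) x v u :=
    (hξ'.contDiffAt hxU).isSymmSndFDerivAt (by
      simpa using WithTop.coe_le_coe.mpr (le_top : (2 : ℕ∞) ≤ ⊤))
  have key : ∀ w u v z, B (fderiv ℝ (fderiv ℝ (fderiv ℝ ξ)) x w u v) z
      = fderiv ℝ (fderiv ℝ Ψ) x w u * B v z + fderiv ℝ (fderiv ℝ Ψ) x w v * B u z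
        - fderiv ℝ (fderiv ℝ Ψ) x w z * B u v := fun w u v z => by
    have h₁ := hasFDerivAt_bilin_apply B
      (ContinuousLinearMap.apply ℝ E v ∘L ContinuousLinearMap.apply ℝ (E →L[ℝ] E) u) hD z
    have hψ' : ∀ t, HasFDerivAt (fun y => fderiv ℝ Ψ y t)
        (ContinuousLinearMap.apply ℝ ℝ t ∘L fderiv ℝ (fderiv ℝ Ψ) x) x := fun t =>
      (ContinuousLinearMap.apply ℝ ℝ t).hasFDerivAt.comp x hψ.hasFDerivAt
    have h₂ := (((hψ' u).mul_const (B v z)).add ((hψ' v).mul_const (B u z))).sub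
      ((hψ' z).mul_const (B u v))
    have h₃ := h₂.congr_of_eventuallyEq
      (f₁ := fun y => B (fderiv ℝ (fderiv ℝ ξ) y u v) z) <| by
      filter_upwards [hxU] with y hy
      simpa using h.bilin_fderiv_fderiv hU hSymm hξ hΨ hy u v z
    have := DFunLike.congr_fun (h₁.unique h₃) w
    simp only [add_apply, sub_apply,
      ContinuousLinearMap.comp_apply, ContinuousLinearMap.flip_apply,
      ContinuousLinearMap.apply_apply, smul_apply, smul_eq_mul] at this
    linarith
  have hsymmψ : ∀ u v, fderiv ℝ (fderiv ℝ Ψ) x u v = fderiv ℝ (fderiv ℝ Ψ) x v u :=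
    (hΨ.contDiffAt hxU).isSymmSndFDerivAt (by
      simpa using WithTop.coe_le_coe.mpr (le_top : (2 : ℕ∞) ≤ ⊤))
  have hH := eq_zero_of_conformal_integrability B.toLinearMap₁₂ hn hSymm hNondeg
    (fderiv ℝ (fderiv ℝ Ψ) x).toLinearMap₁₂ fun w u v z => by
      have h₁ := key w u v z
      have h₂ := key u w v z
      rw [hsymm w u, h₂, hsymmψ u w] at h₁
      change fderiv ℝ (fderiv ℝ Ψ) x w v * B u z - fderiv ℝ (fderiv ℝ Ψ) x w z * B u v
        = fderiv ℝ (fderiv ℝ Ψ) x u v * B w z - fderiv ℝ (fderiv ℝ Ψ) x u z * B w v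
      linarith
  ext u v
  exact LinearMap.congr_fun₂ hH u v

/-- The quadratic vector field with value `c` and derivative `L` at the origin whose special
conformal part is generated by `a`. -/
noncomputable def quadraticField (B : E →L[ℝ] E →L[ℝ] ℝ) (c a : E) (L : E →L[ℝ] E) (x : E) : E :=
  c + B a x • x - (B x x / 2) • a + L x

theorem contDiff_quadraticField (c a : E) (L : E →L[ℝ] E) :
    ContDiff ℝ ∞ (quadraticField B c a L) := by
  unfold quadraticField
  fun_prop

theorem fderiv_quadraticField (hSymm : ∀ u v, B u v = B v u) (c a : E) (L : E →L[ℝ] E)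
    (x u : E) :
    fderiv ℝ (quadraticField B c a L) x u = B a u • x + B a x • u - B x u • a + L u := by
  have hid := hasFDerivAt_id (𝕜 := ℝ) x
  have h₁ := (B a).hasFDerivAt (x := x) |>.smul hid
  have h₂ := ((B.hasFDerivAt (x := x)).clm_apply hid |>.mul_const (2⁻¹ : ℝ)).smul_const a
  have h := ((h₁.const_add c).sub h₂).add (L.hasFDerivAt (x := x))
  have h' : HasFDerivAt (quadraticField B c a L) _ x :=
    h.congr_of_eventuallyEq (Filter.Eventually.of_forall fun y => by
      simp [quadraticField, div_eq_mul_inv])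
  rw [h'.fderiv]
  simp [hSymm u x]
  module

/-- A quadratic field with conformal linear part is a global conformal Killing vector. -/
theorem isConformalKillingOn_quadraticField (hSymm : ∀ u v, B u v = B v u) (c a : E)
    (L : E →L[ℝ] E) (s : ℝ) (hL : ∀ u v, B (L u) v + B u (L v) = 2 * s * B u v) :
    IsConformalKillingOn B (quadraticField B c a L) (fun x => s + B a x) Set.univ := by
  intro x _ u v
  simp only [fderiv_quadraticField hSymm, map_add, map_sub, map_smul,
    add_apply, sub_apply,
    smul_apply, smul_eq_mul]
  rw [hSymm u x, hSymm u a]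
  linarith [hL u v]

/-- In dimension at least three, a conformal Killing vector on a connected open neighbourhood of
the origin coincides with the quadratic field having the same first-order data there. -/
theorem IsConformalKillingOn.eqOn_quadraticField [FiniteDimensional ℝ E]
    (h : IsConformalKillingOn B ξ Ψ U) (hn : 3 ≤ Module.finrank ℝ E)
    (hU : IsOpen U) (hUconn : IsPreconnected U) (h0 : (0 : E) ∈ U)
    (hSymm : ∀ u v, B u v = B v u) (hNondeg : ∀ u, (∀ v, B u v = 0) → u = 0)
    (hξ : ContDiffOn ℝ ∞ ξ U) {a : E} (ha : ∀ u, B a u = fderiv ℝ Ψ 0 u) :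
    U.EqOn ξ (quadraticField B (ξ 0) a (fderiv ℝ ξ 0)) := by
  obtain ⟨b, -, hb⟩ := exists_orthogonal_nonisotropic_basis B.toLinearMap₁₂ hSymm hNondeg
  have hΨ : ContDiffOn ℝ ∞ Ψ U :=
    h.contDiffOn_factor hU hSymm hξ (q := b ⟨0, by omega⟩) (hb _)
  set P := quadraticField B (ξ 0) a (fderiv ℝ ξ 0)
  have hP : ContDiff ℝ ∞ P := contDiff_quadraticField _ _ _
  have hPK := isConformalKillingOn_quadraticField hSymm (ξ 0) a _ (Ψ 0) (h 0 h0)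
  have hfactor : ∀ x, fderiv ℝ (fun y => Ψ 0 + B a y) x = B a := fun x =>
    ((B a).hasFDerivAt.const_add (Ψ 0)).fderiv
  have hdΨ : U.EqOn (fderiv ℝ Ψ) fun _ => B a :=
    hU.eqOn_of_fderiv_eq hUconn
      ((hΨ.fderiv_of_isOpen (m := ∞) hU (by simp)).differentiableOn (by simp))
      (differentiableOn_const _)
      (fun x hx => by
        rw [h.fderiv_fderiv_factor_eq_zero hn hU hSymm hNondeg hξ hΨ hx, fderiv_const_apply])
      h0 (by ext u; exact (ha u).symm)
  have hξ' : ContDiffOn ℝ ∞ (fderiv ℝ ξ) U := hξ.fderiv_of_isOpen hU (by simp)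
  have hP' : ContDiff ℝ ∞ (fderiv ℝ P) := hP.fderiv_right (by simp)
  have hdξ : U.EqOn (fderiv ℝ ξ) (fderiv ℝ P) := by
    refine hU.eqOn_of_fderiv_eq hUconn (hξ'.differentiableOn (by simp))
      (hP'.differentiable (by simp)).differentiableOn (fun x hx => ?_) h0 ?_
    · ext u v
      rw [← sub_eq_zero]
      refine hNondeg _ fun w => ?_
      rw [map_sub, sub_apply, h.bilin_fderiv_fderiv hU hSymm hξ hΨ hx,
        hPK.bilin_fderiv_fderiv isOpen_univ hSymm hP.contDiffOn
          (contDiff_const.add (B a).contDiff).contDiffOn (Set.mem_univ x),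
        hfactor, hdΨ hx, sub_self]
    · ext u
      simp [P, fderiv_quadraticField hSymm]
  exact hU.eqOn_of_fderiv_eq hUconn (hξ.differentiableOn (by simp))
    (hP.differentiable (by simp)).differentiableOn hdξ h0 (by simp [P, quadraticField])

end ConformalKilling


/-- Every local smooth conformal Killing vector `ξ` of a flat metric `B` on a connected
open set `U ∋ 0` (`n ≥ 3`) has the standard polynomial form determined by its first-order
data at `0`; moreover `ω := Ψ(0)·Id − Dξ(0)` is `B`-skew-adjoint and `ξ` extends to a
globally defined conformal Killing vector. Here `a = grad_B Ψ(0)`. -/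
theorem stmt_3 (n : ℕ) (hn : 3 ≤ n)
    (B : (Fin n → ℝ) →ₗ[ℝ] (Fin n → ℝ) →ₗ[ℝ] ℝ)
    (hSymm : ∀ u v, B u v = B v u)
    (hNondeg : ∀ u, (∀ v, B u v = 0) → u = 0)
    (U : Set (Fin n → ℝ)) (hUopen : IsOpen U) (hUconn : IsConnected U)
    (h0 : (0 : Fin n → ℝ) ∈ U)
    (ξ : (Fin n → ℝ) → (Fin n → ℝ)) (Ψ : (Fin n → ℝ) → ℝ)
    (hξsmooth : ContDiffOn ℝ (⊤ : ℕ∞) ξ U)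
    (hCKV : ∀ x ∈ U, ∀ u v,
      B (fderiv ℝ ξ x u) v + B u (fderiv ℝ ξ x v) = 2 * Ψ x * B u v)
    (a : Fin n → ℝ) (ha : ∀ u, B a u = fderiv ℝ Ψ 0 u) :
    (∀ x ∈ U, ξ x = ξ 0 + Ψ 0 • x + (B a x) • x - (B x x / 2) • a
        + (fderiv ℝ ξ 0 x - Ψ 0 • x)) ∧
    (∀ u v, B (Ψ 0 • u - fderiv ℝ ξ 0 u) v = - B u (Ψ 0 • v - fderiv ℝ ξ 0 v)) ∧
    (∃ (ξ' : (Fin n → ℝ) → (Fin n → ℝ)) (Ψ' : (Fin n → ℝ) → ℝ),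
      ContDiff ℝ (⊤ : ℕ∞) ξ' ∧
      (∀ x u v, B (fderiv ℝ ξ' x u) v + B u (fderiv ℝ ξ' x v) = 2 * Ψ' x * B u v) ∧
      ∀ x ∈ U, ξ' x = ξ x) := by
  set Bc := B.toContinuousBilinearMap
  have hK : IsConformalKillingOn Bc ξ Ψ U := hCKV
  have hP := hK.eqOn_quadraticField (by simpa using hn) hUopen hUconn.isPreconnected h0
    hSymm hNondeg hξsmooth ha
  refine ⟨fun x hx => ?_, fun u v => ?_, quadraticField Bc (ξ 0) a (fderiv ℝ ξ 0),
    fun x => Ψ 0 + Bc a x, contDiff_quadraticField _ _ _,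
    fun x => isConformalKillingOn_quadraticField hSymm _ _ _ _ (hK 0 h0) x (Set.mem_univ x),
    fun x hx => (hP hx).symm⟩
  · rw [hP hx]
    simp only [quadraticField, Bc, LinearMap.toContinuousBilinearMap_apply]
    module
  · have := hCKV 0 h0 u v
    simp only [map_sub, map_smul, LinearMap.sub_apply, LinearMap.smul_apply, smul_eq_mul]
    linarith
end

section
/- Let n ≥ 2, let B be a nondegenerate symmetric bilinear form on ℝⁿ, let U ⊆ ℝⁿ be a nonempty open connected set, and let ω : U → ℝ be a smooth positive function satisfying, for all x ∈ U, D²ω(x)(u,v) = φ(x)·B(u,v) for all u,v, where φ(x) := B(grad_B ω(x), grad_B ω(x)) / (2ω(x)). Then φ is constant on U. -/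
/-- If the differential of `ω` is represented by `g` through a nondegenerate bilinear form `B` and
the Hessian of `ω` at `x` is `c • B`, then `g` has derivative `c • id` at `x`. -/
theorem hasFDerivAt_gradient_of_hessian_eq_smul {E : Type*} [NormedAddCommGroup E]
    [NormedSpace ℝ E] [FiniteDimensional ℝ E] {B : E →ₗ[ℝ] E →ₗ[ℝ] ℝ}
    (hB : ∀ u, (∀ v, B u v = 0) → u = 0) {ω : E → ℝ} {g : E → E} {x : E} {c : ℝ}
    (hω : DifferentiableAt ℝ (fderiv ℝ ω) x)
    (hgrad : ∀ᶠ y in nhds x, ∀ u, B (g y) u = fderiv ℝ ω y u)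
    (hHess : ∀ u v, fderiv ℝ (fderiv ℝ ω) x u v = c * B u v) :
    HasFDerivAt g (c • ContinuousLinearMap.id ℝ E) x := by
  let L : E →ₗ[ℝ] E →L[ℝ] ℝ := LinearMap.toContinuousLinearMap.toLinearMap ∘ₗ B
  have hL : L.ker = ⊥ := by
    refine LinearMap.ker_eq_bot'.2 fun u hu => hB u fun v => ?_
    exact DFunLike.congr_fun hu v
  obtain ⟨T, hT⟩ := L.exists_leftInverse_of_injective hL
  have hTL (u : E) : T (L u) = u := LinearMap.congr_fun hT u
  have h := (LinearMap.toContinuousLinearMap T).hasFDerivAt.comp x hω.hasFDerivAt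
  have heq : g =ᶠ[nhds x] LinearMap.toContinuousLinearMap T ∘ fderiv ℝ ω := by
    filter_upwards [hgrad] with y hy
    have hLB : L (g y) = fderiv ℝ ω y := ContinuousLinearMap.ext hy
    change g y = T (fderiv ℝ ω y)
    rw [← hLB, hTL]
  refine (h.congr_of_eventuallyEq heq).congr_fderiv ?_
  ext1 u
  have hLB : fderiv ℝ (fderiv ℝ ω) x u = c • L u := ContinuousLinearMap.ext (hHess u)
  change T (fderiv ℝ (fderiv ℝ ω) x u) = c • u
  rw [hLB, map_smul, hTL]

/-- The quadratic form of a symmetric bilinear form composed with a differentiable map. -/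
theorem LinearMap.hasFDerivAt_apply_self {E : Type*} [NormedAddCommGroup E]
    [NormedSpace ℝ E] [FiniteDimensional ℝ E] (B : E →ₗ[ℝ] E →ₗ[ℝ] ℝ)
    (hB : ∀ u v, B u v = B v u) {g : E → E} {g' : E →L[ℝ] E} {x : E} (hg : HasFDerivAt g g' x) :
    HasFDerivAt (fun y => B (g y) (g y))
      ((2 : ℝ) • (LinearMap.toContinuousLinearMap (B (g x))).comp g') x := by
  let L : E →L[ℝ] E →L[ℝ] ℝ := LinearMap.toContinuousLinearMap
    (LinearMap.toContinuousLinearMap.toLinearMap ∘ₗ B)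
  have h := (L.hasFDerivAt.comp x hg).clm_apply hg
  refine h.congr_fderiv ?_
  ext u
  change B (g x) (g' u) + B (g' u) (g x) = 2 * B (g x) (g' u)
  rw [hB (g' u)]
  ring


/-- If a smooth positive function `ω` on a nonempty open connected `U ⊆ ℝⁿ` (`n ≥ 2`)
satisfies `Hess ω = φ·B` with `φ = B(grad ω, grad ω)/(2ω)` (where `B` is a nondegenerate
symmetric bilinear form and `g` represents the `B`-gradient of `ω`), then `φ` is constant
on `U`. -/
theorem stmt_6 (n : ℕ) (hn : 2 ≤ n)
    (B : (Fin n → ℝ) →ₗ[ℝ] (Fin n → ℝ) →ₗ[ℝ] ℝ)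
    (hSymm : ∀ u v, B u v = B v u)
    (hNondeg : ∀ u, (∀ v, B u v = 0) → u = 0)
    (U : Set (Fin n → ℝ)) (hUopen : IsOpen U) (hUconn : IsConnected U)
    (ω : (Fin n → ℝ) → ℝ) (hωsmooth : ContDiffOn ℝ (⊤ : ℕ∞) ω U)
    (hωpos : ∀ x ∈ U, 0 < ω x)
    (g : (Fin n → ℝ) → (Fin n → ℝ))
    (hgrad : ∀ x ∈ U, ∀ u, B (g x) u = fderiv ℝ ω x u)
    (hHess : ∀ x ∈ U, ∀ u v,
      fderiv ℝ (fderiv ℝ ω) x u v = (B (g x) (g x) / (2 * ω x)) * B u v) :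
    ∀ x ∈ U, ∀ y ∈ U,
      B (g x) (g x) / (2 * ω x) = B (g y) (g y) / (2 * ω y) := by
  have hderiv : ∀ x ∈ U, HasFDerivAt (𝕜 := ℝ) (fun y => B (g y) (g y) / (2 * ω y)) 0 x := by
    intro x hx
    have hωx : ContDiffAt ℝ (⊤ : ℕ∞) ω x := hωsmooth.contDiffAt (hUopen.mem_nhds hx)
    have hDω : DifferentiableAt ℝ (fderiv ℝ ω) x :=
      (hωx.fderiv_right (m := 1) (by norm_cast)).differentiableAt (by norm_num)
    have hgx := hasFDerivAt_gradient_of_hessian_eq_smul hNondeg hDω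
      (Filter.eventually_of_mem (hUopen.mem_nhds hx) hgrad) (hHess x hx)
    have hnum := B.hasFDerivAt_apply_self hSymm hgx
    have hden := (hωx.differentiableAt (by simp)).hasFDerivAt.const_mul (2 : ℝ)
    have hpos := hωpos x hx
    have hinv := (hasDerivAt_inv (by positivity : 2 * ω x ≠ 0)).comp_hasFDerivAt x hden
    refine (hnum.mul hinv).congr_fderiv ?_
    ext1 u
    simp [hgrad x hx]
    field_simp
    ring
  intro x hx y hy
  exact hUopen.is_const_of_fderiv_eq_zero (𝕜 := ℝ) hUconn.isPreconnected
    (fun z hz => (hderiv z hz).differentiableAt.differentiableWithinAt)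
    (fun z hz => (hderiv z hz).fderiv) hx hy
end

section
/- Let B be a nondegenerate symmetric bilinear form on ℝⁿ, let ω₀ > 0 and w ∈ ℝⁿ, and set c := B(w,w)/(2ω₀). Define ω(x) := ω₀ + B(w,x) + (c/2)·B(x,x). Then: (1) ω(0) = ω₀ and grad_B ω(0) = w; (2) B(grad_B ω(x), grad_B ω(x)) = 2c·ω(x) for all x ∈ ℝⁿ, and D²ω(x)(u,v) = c·B(u,v) for all x, u, v; in particular on the open set {x : ω(x) > 0} (which contains 0), ω satisfies D²ω = (B(grad_B ω, grad_B ω)/(2ω))·B. (3) Moreover, ω is the unique such solution: if U is any open connected neighbourhood of 0 and ω' : U → ℝ is a smooth positive function with D²ω'(x) = (B(grad_B ω'(x), grad_B ω'(x))/(2ω'(x)))·B for all x ∈ U, ω'(0) = ω₀ and grad_B ω'(0) = w, then ω' coincides with ω on U. -/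
section ConformalFactor

variable {E : Type*} [NormedAddCommGroup E] [NormedSpace ℝ E]

theorem hasFDerivAt_const_add_linear_add_quadratic (C : E →L[ℝ] E →L[ℝ] ℝ)
    (hC : ∀ u v, C u v = C v u) (a c : ℝ) (w x : E) :
    HasFDerivAt (fun y => a + C w y + (c / 2) * C y y) (C (w + c • x)) x := by
  have h := (((C w).hasFDerivAt (x := x)).const_add a).add
    (((C.hasFDerivAt (x := x)).clm_apply (hasFDerivAt_id x)).const_mul (c / 2))
  refine h.congr_fderiv ?_
  ext u
  simp [hC u x]
  ring

/-- If the gradient `G` of `f` with respect to `C` satisfies `DG = (C(G,G)/(2f)) • id`, then the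
factor `C(G,G)/(2f)` is constant. -/
theorem hasFDerivAt_eikonal_quotient (C : E →L[ℝ] E →L[ℝ] ℝ) (hC : ∀ u v, C u v = C v u)
    {f : E → ℝ} {G : E → E} {x : E} (hx : f x ≠ 0) (hf : HasFDerivAt f (C (G x)) x)
    (hG : HasFDerivAt G ((C (G x) (G x) / (2 * f x)) • ContinuousLinearMap.id ℝ E) x) :
    HasFDerivAt (fun y => C (G y) (G y) / (2 * f y)) (0 : E →L[ℝ] ℝ) x := by
  have h := ((C.hasFDerivAt.comp x hG).clm_apply hG).fun_mul
    ((hasDerivAt_inv (mul_ne_zero two_ne_zero hx)).comp_hasFDerivAt x (hf.const_mul 2))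
  simp only [div_eq_mul_inv (C _ _)] at h ⊢
  refine h.congr_fderiv ?_
  ext u
  simp [hC u (G x)]
  field_simp
  ring

/-- A solution of `Hess f = (C(grad f, grad f)/(2f)) • C` on a connected open set is determined by
its value and gradient at one point. -/
theorem eqOn_of_hessian_eq (C : E →L[ℝ] E →L[ℝ] ℝ) (hC : ∀ u v, C u v = C v u)
    (M : (E →L[ℝ] ℝ) →L[ℝ] E) (hM : ∀ u, M (C u) = u)
    {U : Set E} (hU : IsOpen U) (hUc : IsPreconnected U) (h0 : (0 : E) ∈ U)
    {f : E → ℝ} {G : E → E} (hf2 : ContDiffOn ℝ 2 f U) (hfU : ∀ x ∈ U, f x ≠ 0)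
    (hfG : ∀ x ∈ U, C (G x) = fderiv ℝ f x)
    (hess : ∀ x ∈ U, fderiv ℝ (fderiv ℝ f) x = (C (G x) (G x) / (2 * f x)) • C)
    {c : ℝ} (hc : C (G 0) (G 0) / (2 * f 0) = c) {x : E} (hx : x ∈ U) :
    f x = f 0 + C (G 0) x + (c / 2) * C x x := by
  have hf : ∀ y ∈ U, HasFDerivAt f (C (G y)) y := fun y hy => by
    rw [hfG y hy]
    exact ((hf2.contDiffAt (hU.mem_nhds hy)).differentiableAt (by norm_num)).hasFDerivAt
  have hG : ∀ y ∈ U,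
      HasFDerivAt G ((C (G y) (G y) / (2 * f y)) • ContinuousLinearMap.id ℝ E) y := by
    intro y hy
    have hd : HasFDerivAt (fderiv ℝ f) ((C (G y) (G y) / (2 * f y)) • C) y := by
      rw [← hess y hy]
      exact (((hf2.contDiffAt (hU.mem_nhds hy)).fderiv_right (m := 1)
        (by norm_num)).differentiableAt (by norm_num)).hasFDerivAt
    refine ((M.hasFDerivAt.comp y hd).congr_fderiv ?_).congr_of_eventuallyEq ?_
    · ext u
      simp [hM]
    · filter_upwards [hU.mem_nhds hy] with z hz
      simp [← hfG z hz, hM]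
  have hquot : ∀ y ∈ U, C (G y) (G y) / (2 * f y) = c := by
    intro y hy
    have hd := fun z hz => hasFDerivAt_eikonal_quotient C hC (hfU z hz) (hf z hz) (hG z hz)
    rw [← hc]
    exact hU.is_const_of_fderiv_eq_zero (𝕜 := ℝ) hUc
      (fun z hz => (hd z hz).differentiableAt.differentiableWithinAt)
      (fun z hz => (hd z hz).fderiv) hy h0
  have hGeq : ∀ y ∈ U, G y = G 0 + c • y := by
    have hlin : ∀ z, HasFDerivAt (fun y => G 0 + c • y) (c • ContinuousLinearMap.id ℝ E) z :=
      fun z => ((hasFDerivAt_id z).const_smul c).const_add _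
    exact hU.eqOn_of_fderiv_eq (𝕜 := ℝ) hUc
      (fun z hz => (hG z hz).differentiableAt.differentiableWithinAt)
      (fun z _ => (hlin z).differentiableAt.differentiableWithinAt)
      (fun z hz => by rw [(hG z hz).fderiv, (hlin z).fderiv, hquot z hz]) h0 (by simp)
  have hq := hasFDerivAt_const_add_linear_add_quadratic C hC (f 0) c (G 0)
  exact hU.eqOn_of_fderiv_eq (𝕜 := ℝ) hUc
    (fun z hz => (hf z hz).differentiableAt.differentiableWithinAt)
    (fun z _ => (hq z).differentiableAt.differentiableWithinAt)
    (fun z hz => by rw [(hf z hz).fderiv, (hq z).fderiv, hGeq z hz]) h0 (by simp) hx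

end ConformalFactor


/-- Existence and uniqueness of the normalized conformal factor: with
`c = B(w,w)/(2ω₀)`, the function `ω(x) = ω₀ + B(w,x) + (c/2)·B(x,x)` has value `ω₀`
and `B`-gradient `w` at `0`, its gradient `g(x) = w + c·x` satisfies
`B(grad ω, grad ω) = 2c·ω` and `Hess ω = c·B`, so on `{ω > 0}` it solves
`Hess ω = (B(grad ω,grad ω)/(2ω))·B`; and it is the unique such solution with the given
value and gradient at `0` on any open connected neighbourhood of `0`. -/
theorem stmt_7 (n : ℕ)
    (B : (Fin n → ℝ) →ₗ[ℝ] (Fin n → ℝ) →ₗ[ℝ] ℝ)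
    (hSymm : ∀ u v, B u v = B v u)
    (hNondeg : ∀ u, (∀ v, B u v = 0) → u = 0)
    (ω₀ : ℝ) (hω₀ : 0 < ω₀) (w : Fin n → ℝ)
    (c : ℝ) (hc : c = B w w / (2 * ω₀))
    (ω : (Fin n → ℝ) → ℝ) (hω : ∀ x, ω x = ω₀ + B w x + (c / 2) * B x x)
    (g : (Fin n → ℝ) → (Fin n → ℝ)) (hg : ∀ x, g x = w + c • x) :
    -- (1) value and gradient at 0
    (ω 0 = ω₀ ∧ (∀ u, B w u = fderiv ℝ ω 0 u)) ∧
    -- (2) g is the B-gradient of ω, the eikonal identity and the Hessian identity hold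
    ((∀ x u, B (g x) u = fderiv ℝ ω x u) ∧
     (∀ x, B (g x) (g x) = 2 * c * ω x) ∧
     (∀ x u v, fderiv ℝ (fderiv ℝ ω) x u v = c * B u v) ∧
     ((0 : Fin n → ℝ) ∈ {x | 0 < ω x} ∧ IsOpen {x | 0 < ω x} ∧
      ∀ x, 0 < ω x → ∀ u v,
        fderiv ℝ (fderiv ℝ ω) x u v = (B (g x) (g x) / (2 * ω x)) * B u v)) ∧
    -- (3) uniqueness
    (∀ U : Set (Fin n → ℝ), IsOpen U → IsConnected U → (0 : Fin n → ℝ) ∈ U →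
      ∀ ω' : (Fin n → ℝ) → ℝ, ContDiffOn ℝ (⊤ : ℕ∞) ω' U → (∀ x ∈ U, 0 < ω' x) →
      ∀ g' : (Fin n → ℝ) → (Fin n → ℝ),
        (∀ x ∈ U, ∀ u, B (g' x) u = fderiv ℝ ω' x u) →
        (∀ x ∈ U, ∀ u v,
          fderiv ℝ (fderiv ℝ ω') x u v = (B (g' x) (g' x) / (2 * ω' x)) * B u v) →
        ω' 0 = ω₀ → g' 0 = w → ∀ x ∈ U, ω' x = ω x) := by
  let L : (Fin n → ℝ) →ₗ[ℝ] (Fin n → ℝ) →L[ℝ] ℝ := LinearMap.toContinuousLinearMap.toLinearMap ∘ₗ B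
  let C : (Fin n → ℝ) →L[ℝ] (Fin n → ℝ) →L[ℝ] ℝ := L.toContinuousLinearMap
  have hCB : ∀ u v, C u v = B u v := fun _ _ => rfl
  have hC : ∀ u v, C u v = C v u := hSymm
  have hL : LinearMap.ker L = ⊥ := LinearMap.ker_eq_bot'.2 fun u hu =>
    hNondeg u fun v => congrArg (fun l : (Fin n → ℝ) →L[ℝ] ℝ => l v) hu
  obtain ⟨M, hM⟩ := L.exists_leftInverse_of_injective hL
  have hω0 : ω 0 = ω₀ := by simp [hω]
  have hdω : ∀ x, HasFDerivAt ω (C (g x)) x := fun x => by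
    rw [funext hω, hg]
    exact hasFDerivAt_const_add_linear_add_quadratic C hC ω₀ c w x
  have hess : ∀ x u v, fderiv ℝ (fderiv ℝ ω) x u v = c * B u v := fun x u v => by
    have hd : fderiv ℝ ω = fun y => C (w + c • y) := funext fun y => by
      rw [(hdω y).fderiv, hg]
    have h := C.hasFDerivAt.comp x (((hasFDerivAt_id x).const_smul c).const_add w)
    rw [hd]
    refine (congrArg (fun A => A u v) h.fderiv).trans ?_
    simp [hCB]
  have heik : ∀ x, B (g x) (g x) = 2 * c * ω x := fun x => by
    have hww : B w w = 2 * c * ω₀ := by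
      rw [hc]
      field_simp
    simp only [hg, hω, map_add, map_smul, LinearMap.add_apply, LinearMap.smul_apply, smul_eq_mul,
      hSymm x w, hww]
    ring
  refine ⟨⟨hω0, fun u => ?_⟩, ⟨fun x u => ?_, heik, hess, ?_, ?_, fun x hx u v => ?_⟩, ?_⟩
  · rw [(hdω 0).fderiv, hCB, hg]
    simp
  · rw [(hdω x).fderiv, hCB]
  · simpa [hω0] using hω₀
  · exact isOpen_lt continuous_const
      (continuous_iff_continuousAt.2 fun x => (hdω x).continuousAt)
  · rw [hess, heik]
    field_simp
  · intro U hU hUc h0 ω' hs hpos g' hgrad hhess hω'0 hg'0 x hx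
    rw [hω, eqOn_of_hessian_eq C hC M.toContinuousLinearMap
      (fun u => LinearMap.congr_fun hM u) hU hUc.isPreconnected h0
      (hs.of_le (WithTop.coe_le_coe.2 le_top)) (fun y hy => (hpos y hy).ne')
      (fun y hy => ContinuousLinearMap.ext (hgrad y hy))
      (fun y hy => ContinuousLinearMap.ext fun u => ContinuousLinearMap.ext (hhess y hy u))
      (c := c) (by rw [hω'0, hg'0, hc, hCB]) hx, hω'0, hg'0, hCB, hCB]
end

section
/- Let V be a real vector space of finite dimension m ≥ 1, let B be a nondegenerate symmetric bilinear form on V, and let F be a B-skew-adjoint endomorphism of V (B(Fu, v) = −B(u, Fv) for all u,v). Then there exists a monic real polynomial q of degree ⌊m/2⌋ such that the characteristic polynomial of F² equals q(X)² if m is even, and equals X·q(X)² if m is odd. -/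
open Polynomial in
/-- A polynomial without odd coefficients is a polynomial in `X ^ 2`. -/
theorem Polynomial.expand_contract_two_of_coeff_odd {R : Type*} [CommRing R] {p : R[X]}
    (h : ∀ k, Odd k → p.coeff k = 0) : expand R 2 (contract 2 p) = p := by
  ext k
  rw [coeff_expand two_pos, coeff_contract two_ne_zero]
  split_ifs with hk
  · rw [Nat.div_mul_cancel hk]
  · exact (h k (Nat.not_even_iff_odd.mp fun he => hk he.two_dvd)).symm

open Polynomial in
theorem Polynomial.coeff_eq_zero_of_comp_neg_X {R : Type*} [CommRing R] [IsDomain R] [CharZero R]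
    {p : R[X]} {n : ℕ} (h : p.comp (-X) = C ((-1) ^ n) * p) {k : ℕ} (hk : Odd (k + n)) :
    p.coeff k = 0 := by
  have hc := congrArg (fun r => coeff r k) h
  have hX : (-X : R[X]) = C (-1) * X := by simp
  simp only [hX, comp_C_mul_X_coeff, coeff_C_mul] at hc
  rcases Nat.even_or_odd n with hn | hn
  · have hk' : Odd k := by rw [Nat.odd_add] at hk; exact hk.mpr hn
    rw [hk'.neg_one_pow, hn.neg_one_pow] at hc
    exact self_eq_neg.mp (by linear_combination -hc)
  · have hk' : Even k := by
      rw [Nat.odd_add'] at hk; exact hk.mp hn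
    rw [hk'.neg_one_pow, hn.neg_one_pow] at hc
    exact self_eq_neg.mp (by linear_combination hc)

open Polynomial in
/-- A polynomial with the parity of `n` is `q (X ^ 2)` or `X * q (X ^ 2)`. -/
theorem Polynomial.exists_eq_X_pow_mul_expand_two {R : Type*} [CommRing R] [IsDomain R]
    [CharZero R] {p : R[X]} {n : ℕ} (h : p.comp (-X) = C ((-1) ^ n) * p) :
    ∃ q : R[X], p = X ^ (n % 2) * expand R 2 q := by
  rcases Nat.even_or_odd n with hn | hn
  · refine ⟨contract 2 p, ?_⟩
    rw [expand_contract_two_of_coeff_odd fun k hk =>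
      coeff_eq_zero_of_comp_neg_X h (hk.add_even hn), Nat.even_iff.mp hn, pow_zero, one_mul]
  · refine ⟨contract 2 p.divX, ?_⟩
    have hp : X * p.divX = p := by
      have h0 : p.coeff 0 = 0 := coeff_eq_zero_of_comp_neg_X h (by simpa using hn)
      simpa [h0] using X_mul_divX_add p
    rw [expand_contract_two_of_coeff_odd fun k hk => ?_, Nat.odd_iff.mp hn, pow_one, hp]
    rw [coeff_divX]
    exact coeff_eq_zero_of_comp_neg_X h (hk.add_one.add_odd hn)

section SkewAdjoint

variable {K V : Type*} [Field K] [AddCommGroup V] [Module K V] [FiniteDimensional K V]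

/-- Adjoint endomorphisms for a nondegenerate bilinear form have the same determinant. -/
theorem LinearMap.det_eq_of_isAdjointPair {B : V →ₗ[K] V →ₗ[K] K} (hB : B.SeparatingLeft)
    {f g : V →ₗ[K] V} (h : ∀ u v, B (f u) v = B u (g v)) :
    LinearMap.det f = LinearMap.det g := by
  have hinj : Function.Injective B :=
    LinearMap.ker_eq_bot.mp (LinearMap.separatingLeft_iff_ker_eq_bot.mp hB)
  let e : V ≃ₗ[K] Module.Dual K V :=
    B.linearEquivOfInjective hinj Subspace.dual_finrank_eq.symm
  rw [← LinearMap.det_dualMap g, ← LinearMap.det_conj f e]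
  congr 1
  ext φ v
  obtain ⟨u, rfl⟩ := e.surjective φ
  have he : e.symm (e u) = u := e.symm_apply_apply u
  change B (f (e.symm (e u))) v = B u (g v)
  rw [he, h]

theorem LinearMap.det_algebraMap_add_of_skew {B : V →ₗ[K] V →ₗ[K] K} (hB : B.SeparatingLeft)
    {F : V →ₗ[K] V} (hF : ∀ u v, B (F u) v = -B u (F v)) (t : K) :
    LinearMap.det (algebraMap K (Module.End K V) t + F) =
      LinearMap.det (algebraMap K (Module.End K V) t - F) :=
  det_eq_of_isAdjointPair hB fun u v => by
    simp [Module.algebraMap_end_apply, hF, sub_eq_add_neg]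

open Polynomial in
theorem LinearMap.charpoly_comp_neg_X_of_skew [Infinite K] {B : V →ₗ[K] V →ₗ[K] K}
    (hB : B.SeparatingLeft) {F : V →ₗ[K] V} (hF : ∀ u v, B (F u) v = -B u (F v)) :
    F.charpoly.comp (-X) = C ((-1) ^ Module.finrank K V) * F.charpoly := by
  refine Polynomial.funext fun t => ?_
  rw [eval_comp, eval_mul, eval_C, eval_neg, eval_X, LinearMap.eval_charpoly,
    LinearMap.eval_charpoly, ← det_algebraMap_add_of_skew hB hF, ← LinearMap.det_smul]
  congr 1
  simp only [map_neg, neg_smul, one_smul]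
  abel

open Polynomial in
theorem LinearMap.expand_charpoly_comp_self_of_skew [Infinite K] {B : V →ₗ[K] V →ₗ[K] K}
    (hB : B.SeparatingLeft) {F : V →ₗ[K] V} (hF : ∀ u v, B (F u) v = -B u (F v)) :
    expand K 2 (F ∘ₗ F).charpoly = F.charpoly ^ 2 := by
  refine Polynomial.funext fun t => ?_
  rw [expand_eval, eval_pow, LinearMap.eval_charpoly, LinearMap.eval_charpoly, sq (LinearMap.det _)]
  nth_rw 1 [← det_algebraMap_add_of_skew hB hF]
  rw [← map_mul]
  congr 1
  rw [map_pow, sq]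
  exact Commute.mul_self_sub_mul_self_eq (Algebra.commutes t F)

end SkewAdjoint

/-- For a `B`-skew-adjoint endomorphism `F` of an `m`-dimensional real vector space with
nondegenerate symmetric bilinear form `B`, the characteristic polynomial of `F²` is a
perfect square `q²` (times `X` in odd dimension), with `q` monic of degree `⌊m/2⌋`. -/
theorem stmt_8 (m : ℕ) (hm : 1 ≤ m)
    (V : Type) [AddCommGroup V] [Module ℝ V] [FiniteDimensional ℝ V]
    (hdim : Module.finrank ℝ V = m)
    (B : V →ₗ[ℝ] V →ₗ[ℝ] ℝ)
    (hSymm : ∀ u v, B u v = B v u)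
    (hNondeg : ∀ u, (∀ v, B u v = 0) → u = 0)
    (F : V →ₗ[ℝ] V) (hSkew : ∀ u v, B (F u) v = - B u (F v)) :
    ∃ q : Polynomial ℝ, q.Monic ∧ q.natDegree = m / 2 ∧
      (Even m → (F ∘ₗ F).charpoly = q ^ 2) ∧
      (Odd m → (F ∘ₗ F).charpoly = Polynomial.X * q ^ 2) := by
  have hB : B.SeparatingLeft := hNondeg
  have hexp := LinearMap.expand_charpoly_comp_self_of_skew hB hSkew
  obtain ⟨q, hq⟩ :=
    Polynomial.exists_eq_X_pow_mul_expand_two (LinearMap.charpoly_comp_neg_X_of_skew hB hSkew)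
  rw [hdim] at hq
  have hmonic : (Polynomial.expand ℝ 2 q).Monic :=
    (Polynomial.monic_X_pow (m % 2)).of_mul_monic_left (hq ▸ F.charpoly_monic)
  have hdeg : m = m % 2 + q.natDegree * 2 := by
    rw [← Polynomial.natDegree_expand, ← Polynomial.natDegree_X_pow (R := ℝ) (m % 2),
      ← (Polynomial.monic_X_pow _).natDegree_mul hmonic, ← hq, F.charpoly_natDegree, hdim]
  have hsq : (F ∘ₗ F).charpoly = Polynomial.X ^ (m % 2) * q ^ 2 := by
    apply Polynomial.expand_injective two_pos
    rw [hexp, hq]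
    simp only [map_mul, map_pow, Polynomial.expand_X]
    ring
  refine ⟨q, (Polynomial.monic_expand_iff two_pos).mp hmonic, by omega, fun hm => ?_, fun hm => ?_⟩
  · simpa [Nat.even_iff.mp hm] using hsq
  · simpa [Nat.odd_iff.mp hm] using hsq
end

section
/- Let n ≥ 3 and let B be the standard Minkowski bilinear form of signature (1, n+1) on ℝ^{n+2} (B = diag(−1, 1, …, 1) in the standard basis). For a subspace W ⊆ ℝ^{n+2}, say W is timelike if it contains a vector w with B(w,w) < 0, null if the restriction of B to W is degenerate, and spacelike otherwise. Let F and F' be B-skew-adjoint endomorphisms of ℝ^{n+2}. Then there exists a linear isometry Λ of B (i.e., B(Λu, Λv) = B(u,v) for all u,v) with F' = Λ ∘ F ∘ Λ⁻¹ if and only if: (1) F² and F'² have the same characteristic polynomial, and (2) ker F and ker F' have the same causal type (both timelike, both null, or both spacelike). -/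
/-- The standard Minkowski bilinear form of signature `(1, n+1)` on `ℝ^{n+2}`. -/
noncomputable def mink (n : ℕ) (u v : Fin (n + 2) → ℝ) : ℝ :=
  ∑ i : Fin (n + 2), (if (i : ℕ) = 0 then (-1 : ℝ) else 1) * u i * v i

/-- A subspace is timelike if it contains a vector of negative norm. -/
def MinkTimelike (n : ℕ) (W : Submodule ℝ (Fin (n + 2) → ℝ)) : Prop :=
  ∃ w ∈ W, mink n w w < 0

/-- A subspace is null if the restriction of the Minkowski form to it is degenerate. -/
def MinkNull (n : ℕ) (W : Submodule ℝ (Fin (n + 2) → ℝ)) : Prop :=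
  ∃ w ∈ W, w ≠ 0 ∧ ∀ w' ∈ W, mink n w w' = 0

/-- A subspace is spacelike if it is neither timelike nor null (in particular `{0}` is
spacelike). -/
def MinkSpacelike (n : ℕ) (W : Submodule ℝ (Fin (n + 2) → ℝ)) : Prop :=
  ¬ MinkTimelike n W ∧ ¬ MinkNull n W

/-- A nondegenerate symmetric bilinear form of index at most one: the orthogonal complement of a
negative vector is positive definite. -/
structure IsLorentzian {V : Type*} [AddCommGroup V] [Module ℝ V]
    (B : LinearMap.BilinForm ℝ V) : Prop where
  symm : ∀ x y, B x y = B y x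
  nondeg : ∀ x, (∀ y, B x y = 0) → x = 0
  pos : ∀ x y, B x x < 0 → B x y = 0 → y ≠ 0 → 0 < B y y

/-- Endomorphisms of two spaces with bilinear forms are intertwined by a linear isometry. -/
def IsometricallyConj {V V' : Type*} [AddCommGroup V] [Module ℝ V] [AddCommGroup V'] [Module ℝ V']
    (B : LinearMap.BilinForm ℝ V) (F : V →ₗ[ℝ] V)
    (B' : LinearMap.BilinForm ℝ V') (F' : V' →ₗ[ℝ] V') : Prop :=
  ∃ Λ : V ≃ₗ[ℝ] V', (∀ u v, B' (Λ u) (Λ v) = B u v) ∧ ∀ u, F' (Λ u) = Λ (F u)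

namespace IsLorentzian

section Basic

variable {V : Type*} [AddCommGroup V] [Module ℝ V] {B : LinearMap.BilinForm ℝ V}

lemma exists_smul_apply_self_eq_one {v : V} (hv : 0 < B v v) :
    ∃ c : ℝ, B (c • v) (c • v) = 1 := by
  refine ⟨(Real.sqrt (B v v))⁻¹, ?_⟩
  have h1 := Real.mul_self_sqrt hv.le
  have h2 : Real.sqrt (B v v) ≠ 0 := (Real.sqrt_pos.2 hv).ne'
  simp only [map_smul, LinearMap.smul_apply, smul_eq_mul]
  field_simp
  nlinarith

lemma isRefl (hB : IsLorentzian B) : B.IsRefl := fun x y h => by rw [hB.symm, h]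

lemma nondegenerate (hB : IsLorentzian B) : B.Nondegenerate :=
  ⟨hB.nondeg, fun y h => hB.nondeg y fun x => by rw [hB.symm, h]⟩

/-- A nonzero isotropic vector pairs nontrivially with some vector spanning a Lorentzian plane. -/
lemma exists_neg (hB : IsLorentzian B) {x : V} (hx : x ≠ 0) (hxx : B x x = 0) :
    ∃ z, B x z = 1 ∧ B (x + z) (x + z) < 0 := by
  obtain ⟨z, hz⟩ : ∃ z, B x z ≠ 0 := by
    by_contra! h
    exact hx (hB.nondeg x h)
  set w := (B x z)⁻¹ • z with hw
  have hxw : B x w = 1 := by simp [hw, hz]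
  set c := -(B w w + 3) / 2 with hc
  refine ⟨w + c • x, by simp [hxw, hxx], ?_⟩
  have hwx : B w x = 1 := by rw [hB.symm, hxw]
  simp only [map_add, LinearMap.add_apply, map_smul, LinearMap.smul_apply, smul_eq_mul, hxx, hxw,
    hwx]
  rw [hc]
  linarith

/-- A vector orthogonal to an isotropic vector `x` is positive or a multiple of `x`. -/
lemma pos_or_smul (hB : IsLorentzian B) {x y : V} (hx : x ≠ 0) (hxx : B x x = 0)
    (hxy : B x y = 0) : 0 < B y y ∨ ∃ a : ℝ, y = a • x := by
  obtain ⟨z, hz, hneg⟩ := hB.exists_neg hx hxx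
  by_cases h : y - (B z y) • x = 0
  · exact Or.inr ⟨_, sub_eq_zero.1 h⟩
  left
  have hzx : B z x = 1 := by rw [hB.symm, hz]
  have hyx : B y x = 0 := by rw [hB.symm, hxy]
  have := hB.pos _ _ hneg (by simp [hxx, hxy, hzx]) h
  simpa [hxx, hxy, hyx] using this

/-- A map that kills every vector annihilating its range has range `(ker G)ᗮ`. -/
lemma mem_range [FiniteDimensional ℝ V] (hB : IsLorentzian B) {G : V →ₗ[ℝ] V}
    (hG : ∀ y, (∀ x, B (G x) y = 0) → G y = 0) {k : V} (hk : ∀ y, G y = 0 → B y k = 0) :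
    ∃ u, G u = k := by
  have h := LinearMap.BilinForm.orthogonal_orthogonal hB.nondegenerate hB.isRefl
    (LinearMap.range G)
  have : k ∈ LinearMap.range G := by
    rw [← h]
    intro y hy
    exact hk y (hG y fun x => hy (G x) ⟨x, rfl⟩)
  exact this

variable {F : V →ₗ[ℝ] V}

lemma skew_self (hB : IsLorentzian B) (hF : ∀ u v, B (F u) v = -B u (F v)) (x : V) :
    B x (F x) = 0 := by
  have h1 := hF x x
  have h2 := hB.symm x (F x)
  linarith

/-- The square of a skew endomorphism has a real eigenvector. -/
lemma exists_eigenvector_sq [FiniteDimensional ℝ V] [Nontrivial V] (hB : IsLorentzian B)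
    (hF : ∀ u v, B (F u) v = -B u (F v)) : ∃ (μ : ℝ) (v : V), v ≠ 0 ∧ F (F v) = μ • v := by
  have hint : IsIntegral ℝ F := Algebra.IsIntegral.isIntegral F
  obtain ⟨p, hp, q, hq⟩ := WfDvdMonoid.exists_irreducible_factor (minpoly.not_isUnit ℝ F)
    (minpoly.ne_zero hint)
  have hq0 : q ≠ 0 := by
    rintro rfl
    exact minpoly.ne_zero hint (by simpa using hq)
  have hqF : Polynomial.aeval F q ≠ 0 := by
    intro h
    have h1 := minpoly.degree_le_of_ne_zero ℝ F hq0 h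
    rw [hq, Polynomial.degree_mul, Polynomial.degree_eq_natDegree hp.ne_zero,
      Polynomial.degree_eq_natDegree hq0] at h1
    have h2 := hp.natDegree_pos
    norm_cast at h1
    omega
  obtain ⟨w, hw⟩ : ∃ w, Polynomial.aeval F q w ≠ 0 := by
    by_contra! h
    exact hqF (LinearMap.ext h)
  set x := Polynomial.aeval F q w with hx
  have hpx : Polynomial.aeval F p x = 0 := by
    rw [hx, ← Module.End.mul_apply, ← map_mul, ← hq, minpoly.aeval, LinearMap.zero_apply]
  obtain ⟨a, b, c, habc⟩ : ∃ a b c : ℝ, p = Polynomial.C a * Polynomial.X ^ 2 +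
      Polynomial.C b * Polynomial.X + Polynomial.C c :=
    ⟨_, _, _, Polynomial.eq_quadratic_of_degree_le_two (hp.degree_le_two)⟩
  have key : a • F (F x) + b • F x + c • x = 0 := by
    rw [habc] at hpx
    simpa [Algebra.algebraMap_eq_smul_one, pow_two] using hpx
  by_cases ha : a = 0
  · by_cases hb : b = 0
    · have hc : c = 0 := by simpa [ha, hb, hw] using key
      exact absurd (by simp [habc, ha, hb, hc]) hp.ne_zero
    · have h1 : F x = (-(c / b)) • x := by
        have : b • F x = -(c • x) := by
          rw [ha, zero_smul, zero_add] at key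
          exact eq_neg_of_add_eq_zero_left key
        rw [neg_smul, div_eq_inv_mul, mul_smul, ← smul_neg, ← this, smul_smul,
          inv_mul_cancel₀ hb, one_smul]
      exact ⟨-(c / b) * -(c / b), x, hw, by rw [h1, map_smul, h1, smul_smul]⟩
  have hFF : F (F x) = (-(b / a)) • F x + (-(c / a)) • x := by
    have : a • (F (F x) - ((-(b / a)) • F x + (-(c / a)) • x)) = 0 := by
      rw [← key]
      match_scalars <;> field_simp
    rcases smul_eq_zero.1 this with h | h
    · exact absurd h ha
    · exact sub_eq_zero.1 h
  by_cases hb : b = 0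
  · exact ⟨-(c / a), x, hw, by simpa [hb] using hFF⟩
  have hxy := hB.skew_self hF x
  have hyy : B (F x) (F x) = 0 := by
    have h := hB.skew_self hF (F x)
    rw [hFF] at h
    simp only [map_add, map_smul, smul_eq_mul, hB.symm (F x) x, hxy] at h
    have : b / a ≠ 0 := div_ne_zero hb ha
    have h' : (b / a) * B (F x) (F x) = 0 := by linarith
    exact (mul_eq_zero.1 h').resolve_left this
  by_cases hc : c = 0
  · by_cases hy : F x = 0
    · exact ⟨0, x, hw, by simp [hy]⟩
    · have h1 : F (F x) = (-(b / a)) • F x := by simpa [hc] using hFF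
      exact ⟨-(b / a) * -(b / a), F x, hy, by rw [h1, map_smul, h1, smul_smul]⟩
  have hxx : B x x = 0 := by
    have h := hF x (F x)
    rw [hFF] at h
    simp only [map_add, map_smul, smul_eq_mul, hxy, hyy] at h
    have : c / a ≠ 0 := div_ne_zero hc ha
    have h' : (c / a) * B x x = 0 := by linarith
    exact (mul_eq_zero.1 h').resolve_left this
  rcases hB.pos_or_smul hw hxx hxy with h | ⟨t, ht⟩
  · exact absurd hyy h.ne'
  · exact ⟨t * t, x, hw, by rw [ht, map_smul, ht, smul_smul]⟩

/-- A positive vector can be normalised inside an eigenspace. -/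
lemma exists_unit_eigenvector {μ : ℝ} {v : V} (hv : 0 < B v v) (h : F (F v) = μ • v) :
    ∃ u, B u u = 1 ∧ F (F u) = μ • u := by
  obtain ⟨c, hc⟩ := exists_smul_apply_self_eq_one hv
  exact ⟨c • v, hc, by rw [map_smul, map_smul, h, smul_comm]⟩

lemma exists_unit_ker (hF : ∀ v, F v = 0 → v ≠ 0 → 0 < B v v) {v : V} (hv : v ≠ 0)
    (h : F (F v) = 0) : ∃ u, B u u = 1 ∧ F u = 0 := by
  obtain ⟨w, hw, hFw⟩ : ∃ w, w ≠ 0 ∧ F w = 0 := by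
    by_cases h0 : F v = 0
    · exact ⟨v, hv, h0⟩
    · exact ⟨F v, h0, h⟩
  obtain ⟨c, hc⟩ := exists_smul_apply_self_eq_one (hF w hFw hw)
  exact ⟨c • w, hc, by simp [hFw]⟩

lemma exists_normalized_neg {v : V} (hv : B v v < 0) (h : F v = 0) :
    ∃ u, B u u = -1 ∧ F u = 0 := by
  obtain ⟨c, hc⟩ := exists_smul_apply_self_eq_one (B := -B) (v := v) (by simpa using hv)
  exact ⟨c • v, by rw [← hc]; simp, by simp [h]⟩

/-- The eigenspaces of the square for nonzero eigenvalues contain unit vectors. -/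
lemma exists_unit_of_ne_zero [FiniteDimensional ℝ V] (hB : IsLorentzian B)
    (hF : ∀ u v, B (F u) v = -B u (F v)) {μ : ℝ} (hμ : μ ≠ 0) {v : V} (hv : v ≠ 0)
    (h : F (F v) = μ • v) : ∃ u, B u u = 1 ∧ F (F u) = μ • u := by
  have hFv : F v ≠ 0 := by
    intro h0
    rw [h0, map_zero] at h
    exact (smul_ne_zero hμ hv) h.symm
  rcases lt_trichotomy (B v v) 0 with hneg | hnull | hpos
  · exact exists_unit_eigenvector (hB.pos _ _ hneg (hB.skew_self hF v) hFv)
      (by rw [h, map_smul])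
  · have hnn : B (F v) (F v) = 0 := by rw [hF, h]; simp [hnull]
    rcases hB.pos_or_smul hv hnull (hB.skew_self hF v) with hp | ⟨a, ha⟩
    · exact absurd hnn hp.ne'
    have haa : a * a = μ := by
      have : (a * a) • v = μ • v := by rw [← h, ha, map_smul, ha, smul_smul]
      exact smul_left_injective ℝ hv this
    have ha0 : a ≠ 0 := by rintro rfl; exact hμ (by simpa using haa.symm)
    have hinj : ¬ Function.Injective (F + a • LinearMap.id : V →ₗ[ℝ] V) := by
      intro hi
      have hs := LinearMap.surjective_of_injective hi
      apply hv
      refine hB.nondeg v fun y => ?_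
      obtain ⟨x, rfl⟩ := hs y
      have := hF v x
      rw [ha] at this
      simp only [map_smul, LinearMap.smul_apply, smul_eq_mul] at this
      simp only [LinearMap.add_apply, LinearMap.smul_apply, LinearMap.id_apply, map_add, map_smul,
        smul_eq_mul]
      linarith
    obtain ⟨l, hl, hl0⟩ : ∃ l, (F + a • LinearMap.id : V →ₗ[ℝ] V) l = 0 ∧ l ≠ 0 := by
      by_contra! hcon
      exact hinj ((injective_iff_map_eq_zero _).2 hcon)
    have hFl : F l = (-a) • l := by
      rw [neg_smul]
      exact eq_neg_of_add_eq_zero_left (by simpa using hl)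
    have hll : B l l = 0 := by
      have := hB.skew_self hF l
      rw [hFl, map_smul, smul_eq_mul] at this
      exact (mul_eq_zero.1 this).resolve_left (neg_ne_zero.2 ha0)
    have hvl : B v l ≠ 0 := by
      intro h0
      rcases hB.pos_or_smul hv hnull h0 with hp | ⟨t, ht⟩
      · exact hp.ne' hll
      · have h1 : (-a) • l = a • l := by rw [← hFl, ht, map_smul, ha, smul_comm]
        have h2 := smul_left_injective ℝ hl0 h1
        exact ha0 (by linarith)
    refine exists_unit_eigenvector (v := v + (B v l)⁻¹ • l) ?_ ?_
    · have hlv : B l v = B v l := hB.symm _ _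
      simp [hnull, hll, hlv, hvl]
    · simp only [map_add, map_smul, ha, hFl, smul_add, smul_smul, ← haa]
      congr 2
      ring
  · exact exists_unit_eigenvector hpos h

/-- If `ker F` is null then `F` has a nilpotent Jordan chain of length three in normal form. -/
lemma exists_chain [FiniteDimensional ℝ V] (hB : IsLorentzian B)
    (hF : ∀ u v, B (F u) v = -B u (F v)) {k : V} (hk : k ≠ 0) (hFk : F k = 0)
    (hrad : ∀ x, F x = 0 → B k x = 0) :
    ∃ v, B v v = 0 ∧ B (F v) (F v) = 1 ∧ F (F (F v)) = 0 := by
  obtain ⟨s, hs⟩ := hB.mem_range (G := F) (fun y hy => hB.nondeg _ fun x => by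
    rw [hF, hB.symm, hy, neg_zero]) (k := k) fun y hy => by rw [hB.symm, hrad y hy]
  have hkk := hrad k hFk
  have hsk : B s k = 0 := by rw [← hs]; exact hB.skew_self hF s
  obtain ⟨u, hu⟩ := hB.mem_range (G := F ∘ₗ F) (fun y hy => hB.nondeg _ fun x => by
      have := hy x
      rw [LinearMap.comp_apply, hB.symm] at this
      rw [LinearMap.comp_apply, hF, hF, this, neg_zero, neg_zero]) (k := k) fun y hy => by
    rw [LinearMap.comp_apply] at hy
    rcases hB.pos_or_smul hk hkk (hrad _ hy) with hp | ⟨c, hc⟩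
    · refine absurd ?_ hp.ne'
      rw [hF, hy, map_zero, neg_zero]
    · rw [hB.symm, ← hs, hF, hc, map_smul, hsk]
      simp
  rw [LinearMap.comp_apply] at hu
  have hpos : 0 < B (F u) (F u) := by
    rcases hB.pos_or_smul hk hkk (y := F u) (by
      rw [hB.symm, ← hu]; exact hB.skew_self hF _) with hp | ⟨c, hc⟩
    · exact hp
    · rw [hc, map_smul, hFk, smul_zero] at hu
      exact absurd hu.symm hk
  set r := B (F u) (F u) with hr
  have huk : B u k = -r := by
    rw [← hu, hr, hF]; ring
  have hku : B k u = -r := by rw [hB.symm, huk]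
  refine ⟨(Real.sqrt r)⁻¹ • (u + (B u u / (2 * r)) • k), ?_, ?_, ?_⟩
  · simp only [map_add, map_smul, LinearMap.add_apply, LinearMap.smul_apply, smul_eq_mul, hkk, huk,
      hku]
    field_simp
    ring
  · have h1 := Real.mul_self_sqrt hpos.le
    have h2 : Real.sqrt r ≠ 0 := (Real.sqrt_pos.2 hpos).ne'
    simp only [map_add, map_smul, LinearMap.smul_apply, smul_eq_mul, hFk, smul_zero,
      add_zero, ← hr]
    field_simp
    nlinarith
  · simp [hu, hFk]

/-- The map sending coordinates to the combination of the chain `v, F v, F (F v)`. -/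
def chainMap (F : V →ₗ[ℝ] V) (v : V) : ℝ × ℝ × ℝ →ₗ[ℝ] V :=
  (LinearMap.toSpanSingleton ℝ V v).coprod
    ((LinearMap.toSpanSingleton ℝ V (F v)).coprod (LinearMap.toSpanSingleton ℝ V (F (F v))))

lemma chainMap_gram (hB : IsLorentzian B) (hF : ∀ u v, B (F u) v = -B u (F v)) {v : V}
    (h0 : B v v = 0) (h1 : B (F v) (F v) = 1) (h3 : F (F (F v)) = 0) (s t : ℝ × ℝ × ℝ) :
    B (chainMap F v s) (chainMap F v t) = s.2.1 * t.2.1 - s.1 * t.2.2 - s.2.2 * t.1 := by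
  have a1 := hB.skew_self hF v
  have a2 := hB.skew_self hF (F v)
  have a3 : B v (F (F v)) = -1 := by have := hF v (F v); linarith
  have a4 : B (F (F v)) (F (F v)) = 0 := by rw [hF, h3, map_zero, neg_zero]
  simp only [chainMap, LinearMap.coprod_apply, LinearMap.toSpanSingleton_apply, map_add, map_smul,
    LinearMap.add_apply, LinearMap.smul_apply, smul_eq_mul, hB.symm (F v) v,
    hB.symm (F (F v)) v, hB.symm (F (F v)) (F v), h0, h1, a1, a2, a3, a4]
  ring

end Basic

section Split

variable {V V' T : Type*} [AddCommGroup V] [Module ℝ V] [AddCommGroup V'] [Module ℝ V']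
  [AddCommGroup T] [Module ℝ T] [FiniteDimensional ℝ V] [FiniteDimensional ℝ V']
  [FiniteDimensional ℝ T]
  {B : LinearMap.BilinForm ℝ V} {B' : LinearMap.BilinForm ℝ V'}
  {F : V →ₗ[ℝ] V} {F' : V' →ₗ[ℝ] V'}

/-- Splitting off a nondegenerate invariant subspace parametrised by `j`. -/
lemma exists_split (hB : IsLorentzian B) (hF : ∀ u v, B (F u) v = -B u (F v))
    (j : T →ₗ[ℝ] V) (A : T →ₗ[ℝ] T) (hj : ∀ t, F (j t) = j (A t))
    (hnd : ∀ t, (∀ s, B (j t) (j s) = 0) → t = 0) :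
    ∃ (W : Submodule ℝ V) (G : W →ₗ[ℝ] W) (e : (T × W) ≃ₗ[ℝ] V),
      (∀ w, (G w : V) = F w) ∧ (∀ w ∈ W, ∀ t, B (j t) w = 0) ∧ (∀ p, e p = j p.1 + p.2) ∧
      IsLorentzian (B.restrict W) ∧
      (F ∘ₗ F).charpoly = (A ∘ₗ A).charpoly * (G ∘ₗ G).charpoly := by
  set W := B.orthogonal (LinearMap.range j) with hW
  have hWm : ∀ w ∈ W, ∀ t, B (j t) w = 0 := fun w hw t => hw (j t) ⟨t, rfl⟩
  have hFW : ∀ w ∈ W, F w ∈ W := by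
    rintro w hw _ ⟨t, rfl⟩
    have h1 := hF (j t) w
    rw [hj, hWm w hw] at h1
    change B (j t) (F w) = 0
    linarith
  set f : (T × W) →ₗ[ℝ] V := j.coprod W.subtype with hf
  have hfa : ∀ p, f p = j p.1 + p.2 := fun p => by simp [hf]
  have hinj : Function.Injective f := by
    refine (injective_iff_map_eq_zero _).2 fun p hp => ?_
    rw [hfa] at hp
    have h1 : p.1 = 0 := hnd _ fun s => by
      have h2 := congrArg (B (j s)) hp
      rw [map_add, hWm _ p.2.2, map_zero, add_zero] at h2
      rw [hB.symm, h2]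
    have h2 : p.2 = 0 := by
      rw [h1, map_zero, zero_add] at hp
      exact Subtype.ext hp
    exact Prod.ext h1 h2
  have hsurj : Function.Surjective f := by
    intro x
    set g : T →ₗ[ℝ] Module.Dual ℝ T := (LinearMap.lcomp ℝ ℝ j) ∘ₗ B ∘ₗ j with hg
    have hga : ∀ s t, g s t = B (j s) (j t) := fun s t => rfl
    have hgi : Function.Injective g := by
      refine (injective_iff_map_eq_zero _).2 fun t ht => hnd t fun s => ?_
      rw [← hga, ht, LinearMap.zero_apply]
    have hgs : Function.Surjective g :=
      (LinearMap.injective_iff_surjective_of_finrank_eq_finrank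
        (Subspace.dual_finrank_eq (K := ℝ) (V := T)).symm).1 hgi
    obtain ⟨t, ht⟩ := hgs (B x ∘ₗ j)
    have hmem : x - j t ∈ W := by
      rintro _ ⟨s, rfl⟩
      change B (j s) (x - j t) = 0
      have := LinearMap.congr_fun ht s
      rw [hga, LinearMap.comp_apply] at this
      rw [map_sub, hB.symm, ← this, hB.symm, sub_self]
    exact ⟨(t, ⟨_, hmem⟩), by rw [hfa]; simp⟩
  set e := LinearEquiv.ofBijective f ⟨hinj, hsurj⟩ with he
  have hea : ∀ p, e p = j p.1 + p.2 := hfa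
  set G : W →ₗ[ℝ] W := F.restrict hFW with hG
  have hGa : ∀ w, (G w : V) = F w := fun w => rfl
  refine ⟨W, G, e, hGa, hWm, hea, ⟨fun x y => hB.symm _ _, fun x hx => ?_, fun x y h1 h2 h3 =>
    hB.pos _ _ h1 h2 (by simpa using h3)⟩, ?_⟩
  · refine Subtype.ext (hB.nondeg _ fun y => ?_)
    obtain ⟨p, rfl⟩ := e.surjective y
    rw [hea, map_add, hB.symm, hWm _ x.2, zero_add]
    exact hx p.2
  · rw [← LinearMap.charpoly_prodMap, ← e.charpoly_conj]
    congr 1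
    refine LinearMap.ext fun y => ?_
    obtain ⟨p, rfl⟩ := e.surjective y
    rw [LinearEquiv.conj_apply_apply, e.symm_apply_apply, hea, hea]
    simp [hj, hGa]

/-- Isometric conjugacy may be checked after splitting off isomorphic invariant subspaces. -/
lemma isometricallyConj_of_split (hB : IsLorentzian B) (hF : ∀ u v, B (F u) v = -B u (F v))
    (hB' : IsLorentzian B') (hF' : ∀ u v, B' (F' u) v = -B' u (F' v))
    (hchar : (F ∘ₗ F).charpoly = (F' ∘ₗ F').charpoly)
    (j : T →ₗ[ℝ] V) (j' : T →ₗ[ℝ] V') (A : T →ₗ[ℝ] T)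
    (hj : ∀ t, F (j t) = j (A t)) (hj' : ∀ t, F' (j' t) = j' (A t))
    (hjj : ∀ s t, B' (j' s) (j' t) = B (j s) (j t))
    (hnd : ∀ t, (∀ s, B (j t) (j s) = 0) → t = 0)
    (h : ∀ (W : Submodule ℝ V) (W' : Submodule ℝ V') (G : W →ₗ[ℝ] W) (G' : W' →ₗ[ℝ] W'),
      (∀ w, (G w : V) = F w) → (∀ w, (G' w : V') = F' w) →
      (∀ w ∈ W, ∀ t, B (j t) w = 0) → (∀ w ∈ W', ∀ t, B' (j' t) w = 0) →
      IsLorentzian (B.restrict W) → IsLorentzian (B'.restrict W') →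
      Module.finrank ℝ T + Module.finrank ℝ W = Module.finrank ℝ V →
      (G ∘ₗ G).charpoly = (G' ∘ₗ G').charpoly →
      IsometricallyConj (B.restrict W) G (B'.restrict W') G') :
    IsometricallyConj B F B' F' := by
  obtain ⟨W, G, e, hG, hW, he, hL, hc⟩ := hB.exists_split hF j A hj hnd
  obtain ⟨W', G', e', hG', hW', he', hL', hc'⟩ := hB'.exists_split hF' j' A hj'
    fun t ht => hnd t fun s => by rw [← hjj, ht]
  obtain ⟨Λ, hΛ, hΛF⟩ := h W W' G G' hG hG' hW hW' hL hL'
    (by rw [← Module.finrank_prod, e.finrank_eq])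
    (mul_left_cancel₀ (LinearMap.charpoly_monic (A ∘ₗ A)).ne_zero (by rw [← hc, ← hc', hchar]))
  have hL : ∀ p, (e.symm.trans (((LinearEquiv.refl ℝ T).prodCongr Λ).trans e')) (e p) =
      j' p.1 + Λ p.2 := fun p => by simp [he']
  refine ⟨e.symm.trans (((LinearEquiv.refl ℝ T).prodCongr Λ).trans e'), fun u v => ?_, fun u => ?_⟩
  · obtain ⟨p, rfl⟩ := e.surjective u
    obtain ⟨q, rfl⟩ := e.surjective v
    rw [hL, hL, he, he]
    have h1 : B' (Λ p.2 : V') (Λ q.2 : V') = B (p.2 : V) (q.2 : V) := hΛ _ _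
    simp only [map_add, LinearMap.add_apply, hW _ (Subtype.property _),
      hW' _ (Subtype.property _), hB.symm (p.2 : V) (j q.1), hB'.symm (Λ p.2 : V') (j' q.1), hjj,
      h1]
  · obtain ⟨p, rfl⟩ := e.surjective u
    have h1 : F (e p) = e (A p.1, G p.2) := by
      rw [he, he, map_add, hj, hG]
    rw [h1, hL, hL, map_add, hj', ← hG', hΛF]

end Split

section Classification

variable {V V' : Type*} [AddCommGroup V] [Module ℝ V] [AddCommGroup V'] [Module ℝ V']
  [FiniteDimensional ℝ V] [FiniteDimensional ℝ V']
  {B : LinearMap.BilinForm ℝ V} {B' : LinearMap.BilinForm ℝ V'}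
  {F : V →ₗ[ℝ] V} {F' : V' →ₗ[ℝ] V'}

lemma exists_eigenvector_of_charpoly_eq (hchar : (F ∘ₗ F).charpoly = (F' ∘ₗ F').charpoly)
    {μ : ℝ} {v : V} (hv : v ≠ 0) (h : F (F v) = μ • v) :
    ∃ v', v' ≠ 0 ∧ F' (F' v') = μ • v' := by
  have h1 : Module.End.HasEigenvalue (F ∘ₗ F) μ :=
    Module.End.hasEigenvalue_of_hasEigenvector
      (x := v) ⟨Module.End.mem_eigenspace_iff.2 h, hv⟩
  rw [Module.End.hasEigenvalue_iff_isRoot_charpoly, hchar,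
    ← Module.End.hasEigenvalue_iff_isRoot_charpoly] at h1
  obtain ⟨v', hv'⟩ := h1.exists_hasEigenvector
  exact ⟨v', hv'.2, hv'.apply_eq_smul⟩

end Classification

universe u u'

/-- Skew endomorphisms with positive definite kernels are classified by the characteristic
polynomial of their square. -/
theorem isometricallyConj_of_ker_pos (d : ℕ) :
    ∀ {V : Type u} {V' : Type u'} [AddCommGroup V] [Module ℝ V] [AddCommGroup V'] [Module ℝ V']
      [FiniteDimensional ℝ V] [FiniteDimensional ℝ V']
      {B : LinearMap.BilinForm ℝ V} {B' : LinearMap.BilinForm ℝ V'}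
      {F : V →ₗ[ℝ] V} {F' : V' →ₗ[ℝ] V'}, Module.finrank ℝ V = d →
      IsLorentzian B → IsLorentzian B' →
      (∀ u v, B (F u) v = -B u (F v)) → (∀ u v, B' (F' u) v = -B' u (F' v)) →
      (F ∘ₗ F).charpoly = (F' ∘ₗ F').charpoly →
      (∀ v, F v = 0 → v ≠ 0 → 0 < B v v) → (∀ v, F' v = 0 → v ≠ 0 → 0 < B' v v) →
      IsometricallyConj B F B' F' := by
  induction d using Nat.strong_induction_on with
  | _ d ih =>
  intro V V' _ _ _ _ _ _ B B' F F' hd hB hB' hF hF' hchar hker hker'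
  have hdim : Module.finrank ℝ V = Module.finrank ℝ V' := by
    rw [← (F ∘ₗ F).charpoly_natDegree, hchar, LinearMap.charpoly_natDegree]
  rcases subsingleton_or_nontrivial V with hV | hV
  · have : Subsingleton V' := by
      rw [← Module.finrank_zero_iff (R := ℝ), ← hdim, Module.finrank_zero_iff]
      exact hV
    exact ⟨0, fun u v => by simp [Subsingleton.elim u 0], fun u => Subsingleton.elim _ _⟩
  obtain ⟨μ, v, hv, hFv⟩ := hB.exists_eigenvector_sq hF
  obtain ⟨v', hv', hFv'⟩ := exists_eigenvector_of_charpoly_eq hchar hv hFv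
  by_cases hμ : μ = 0
  · subst hμ
    rw [zero_smul] at hFv hFv'
    obtain ⟨u, hu, hFu⟩ := exists_unit_ker hker hv hFv
    obtain ⟨u', hu', hFu'⟩ := exists_unit_ker hker' hv' hFv'
    refine isometricallyConj_of_split hB hF hB' hF' hchar (LinearMap.toSpanSingleton ℝ V u)
      (LinearMap.toSpanSingleton ℝ V' u') 0 (by simp [hFu]) (by simp [hFu'])
      (by simp [hu, hu']) (fun t ht => by simpa [hu] using ht 1) ?_
    intro W W' G G' hG hG' hW hW' hL hL' hfr hc
    refine ih _ ?_ rfl hL hL' (fun x y => ?_) (fun x y => ?_) hc (fun x hx hx0 => ?_)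
      fun x hx hx0 => ?_
    · rw [Module.finrank_self] at hfr
      omega
    · simpa [hG] using hF x y
    · simpa [hG'] using hF' x y
    · exact hker x (by rw [← hG, hx]; rfl) (by simpa using hx0)
    · exact hker' x (by rw [← hG', hx]; rfl) (by simpa using hx0)
  · obtain ⟨u, hu, hFu⟩ := hB.exists_unit_of_ne_zero hF hμ hv hFv
    obtain ⟨u', hu', hFu'⟩ := hB'.exists_unit_of_ne_zero hF' hμ hv' hFv'
    have hs := hB.skew_self hF u
    have hs' := hB'.skew_self hF' u'
    have hn : B (F u) (F u) = -μ := by simp [hF, hFu, hu]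
    have hn' : B' (F' u') (F' u') = -μ := by simp [hF', hFu', hu']
    have hr : B (F u) u = 0 := by rw [hB.symm, hs]
    have hr' : B' (F' u') u' = 0 := by rw [hB'.symm, hs']
    refine isometricallyConj_of_split (T := ℝ × ℝ) hB hF hB' hF' hchar
      ((LinearMap.toSpanSingleton ℝ V u).coprod (LinearMap.toSpanSingleton ℝ V (F u)))
      ((LinearMap.toSpanSingleton ℝ V' u').coprod (LinearMap.toSpanSingleton ℝ V' (F' u')))
      ((μ • LinearMap.snd ℝ ℝ ℝ).prod (LinearMap.fst ℝ ℝ ℝ)) ?_ ?_ ?_ ?_ ?_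
    · intro t
      simp [hFu, smul_smul, mul_comm, add_comm]
    · intro t
      simp [hFu', smul_smul, mul_comm, add_comm]
    · intro s t
      simp [hu, hu', hs, hs', hn, hn', hr, hr']
    · intro t ht
      have h1 := ht (1, 0)
      have h2 := ht (0, 1)
      simp [hu, hs, hr, hn, hμ] at h1 h2
      exact Prod.ext h1 h2
    intro W W' G G' hG hG' hW hW' hL hL' hfr hc
    refine ih _ ?_ rfl hL hL' (fun x y => ?_) (fun x y => ?_) hc (fun x hx hx0 => ?_)
      fun x hx hx0 => ?_
    · rw [Module.finrank_prod, Module.finrank_self] at hfr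
      omega
    · simpa [hG] using hF x y
    · simpa [hG'] using hF' x y
    · exact hker x (by rw [← hG, hx]; rfl) (by simpa using hx0)
    · exact hker' x (by rw [← hG', hx]; rfl) (by simpa using hx0)

section Classification

variable {V V' : Type*} [AddCommGroup V] [Module ℝ V] [AddCommGroup V'] [Module ℝ V']
  [FiniteDimensional ℝ V] [FiniteDimensional ℝ V']
  {B : LinearMap.BilinForm ℝ V} {B' : LinearMap.BilinForm ℝ V'}
  {F : V →ₗ[ℝ] V} {F' : V' →ₗ[ℝ] V'}

/-- A split off subspace containing a negative vector leaves positive definite complements, so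
isometric conjugacy follows from equality of characteristic polynomials. -/
lemma isometricallyConj_of_split_neg {T : Type*} [AddCommGroup T] [Module ℝ T]
    [FiniteDimensional ℝ T] (hB : IsLorentzian B) (hF : ∀ u v, B (F u) v = -B u (F v))
    (hB' : IsLorentzian B') (hF' : ∀ u v, B' (F' u) v = -B' u (F' v))
    (hchar : (F ∘ₗ F).charpoly = (F' ∘ₗ F').charpoly)
    (j : T →ₗ[ℝ] V) (j' : T →ₗ[ℝ] V') (A : T →ₗ[ℝ] T)
    (hj : ∀ t, F (j t) = j (A t)) (hj' : ∀ t, F' (j' t) = j' (A t))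
    (hjj : ∀ s t, B' (j' s) (j' t) = B (j s) (j t))
    (hnd : ∀ t, (∀ s, B (j t) (j s) = 0) → t = 0) {t : T} (ht : B (j t) (j t) < 0) :
    IsometricallyConj B F B' F' := by
  refine isometricallyConj_of_split hB hF hB' hF' hchar j j' A hj hj' hjj hnd ?_
  intro W W' G G' hG hG' hW hW' hL hL' _ hc
  refine isometricallyConj_of_ker_pos _ rfl hL hL' (fun x y => ?_) (fun x y => ?_) hc
    (fun x _ hx0 => ?_) fun x _ hx0 => ?_
  · simpa [hG] using hF x y
  · simpa [hG'] using hF' x y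
  · exact hB.pos _ _ ht (hW _ x.2 t) (by simpa using hx0)
  · exact hB'.pos _ _ ((hjj t t).trans_lt ht) (hW' _ x.2 t) (by simpa using hx0)

theorem isometricallyConj_of_ker_neg (hB : IsLorentzian B) (hF : ∀ u v, B (F u) v = -B u (F v))
    (hB' : IsLorentzian B') (hF' : ∀ u v, B' (F' u) v = -B' u (F' v))
    (hchar : (F ∘ₗ F).charpoly = (F' ∘ₗ F').charpoly)
    {v : V} (hv : B v v < 0) (hFv : F v = 0) {v' : V'} (hv' : B' v' v' < 0) (hFv' : F' v' = 0) :
    IsometricallyConj B F B' F' := by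
  obtain ⟨u, hu, hFu⟩ := exists_normalized_neg hv hFv
  obtain ⟨u', hu', hFu'⟩ := exists_normalized_neg hv' hFv'
  exact isometricallyConj_of_split_neg hB hF hB' hF' hchar (LinearMap.toSpanSingleton ℝ V u)
      (LinearMap.toSpanSingleton ℝ V' u') 0 (by simp [hFu]) (by simp [hFu'])
      (by simp [hu, hu']) (fun t ht => by simpa [hu] using ht 1) (t := 1) (by simp [hu])

theorem isometricallyConj_of_ker_null (hB : IsLorentzian B) (hF : ∀ u v, B (F u) v = -B u (F v))
    (hB' : IsLorentzian B') (hF' : ∀ u v, B' (F' u) v = -B' u (F' v))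
    (hchar : (F ∘ₗ F).charpoly = (F' ∘ₗ F').charpoly)
    {k : V} (hk : k ≠ 0) (hFk : F k = 0) (hrad : ∀ x, F x = 0 → B k x = 0)
    {k' : V'} (hk' : k' ≠ 0) (hFk' : F' k' = 0) (hrad' : ∀ x, F' x = 0 → B' k' x = 0) :
    IsometricallyConj B F B' F' := by
  obtain ⟨v, h0, h1, h3⟩ := hB.exists_chain hF hk hFk hrad
  obtain ⟨v', h0', h1', h3'⟩ := hB'.exists_chain hF' hk' hFk' hrad'
  refine isometricallyConj_of_split_neg hB hF hB' hF' hchar (chainMap F v) (chainMap F' v')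
    ((0 : ℝ × ℝ × ℝ →ₗ[ℝ] ℝ).prod ((LinearMap.fst ℝ ℝ (ℝ × ℝ)).prod
      (LinearMap.fst ℝ ℝ ℝ ∘ₗ LinearMap.snd ℝ ℝ (ℝ × ℝ))))
    (fun t => by simp [chainMap, h3]) (fun t => by simp [chainMap, h3'])
    (fun s t => by rw [hB.chainMap_gram hF h0 h1 h3, hB'.chainMap_gram hF' h0' h1' h3'])
    (fun t ht => ?_) (t := (1, 0, 1)) (by rw [hB.chainMap_gram hF h0 h1 h3]; norm_num)
  simp only [hB.chainMap_gram hF h0 h1 h3] at ht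
  have e1 := ht (1, 0, 0)
  have e2 := ht (0, 1, 0)
  have e3 := ht (0, 0, 1)
  simp at e1 e2 e3
  exact Prod.ext e3 (Prod.ext e2 e1)

end Classification

section Minkowski

/-- The Minkowski form as a bilinear form. -/
noncomputable def minkForm (n : ℕ) : LinearMap.BilinForm ℝ (Fin (n + 2) → ℝ) :=
  LinearMap.mk₂ ℝ (mink n)
    (fun x y z => by simp only [mink, Pi.add_apply, mul_add, add_mul, Finset.sum_add_distrib])
    (fun c x y => by
      simp only [mink, Pi.smul_apply, smul_eq_mul, Finset.mul_sum]
      exact Finset.sum_congr rfl fun i _ => by ring)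
    (fun x y z => by simp only [mink, Pi.add_apply, mul_add, Finset.sum_add_distrib])
    (fun c x y => by
      simp only [mink, Pi.smul_apply, smul_eq_mul, Finset.mul_sum]
      exact Finset.sum_congr rfl fun i _ => by ring)

@[simp] lemma minkForm_apply (n : ℕ) (u v : Fin (n + 2) → ℝ) : minkForm n u v = mink n u v := rfl

lemma mink_eq (n : ℕ) (u v : Fin (n + 2) → ℝ) :
    mink n u v = -(u 0 * v 0) + ∑ i : Fin (n + 1), u i.succ * v i.succ := by
  simp [mink, Fin.sum_univ_succ]

lemma isLorentzian_minkForm (n : ℕ) : IsLorentzian (minkForm n) where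
  symm x y := by
    rw [minkForm_apply, minkForm_apply, mink_eq, mink_eq]
    simp only [mul_comm]
  nondeg x hx := by
    funext i
    have := hx (Pi.single i 1)
    rw [minkForm_apply, mink, Finset.sum_eq_single i (fun j _ hj => by simp [hj]) (by simp)] at this
    rw [Pi.single_eq_same, mul_one] at this
    refine (mul_eq_zero.1 this).resolve_left ?_
    split_ifs <;> norm_num
  pos x y hx hxy hy := by
    rw [minkForm_apply, mink_eq] at *
    have cs := Finset.sum_mul_sq_le_sq_mul_sq Finset.univ (fun i : Fin (n + 1) => x i.succ)
      (fun i => y i.succ)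
    simp only [← pow_two] at *
    set p := ∑ i : Fin (n + 1), x i.succ ^ 2
    set q := ∑ i : Fin (n + 1), y i.succ ^ 2 with hq
    have hp0 : 0 ≤ p := Finset.sum_nonneg fun i _ => sq_nonneg _
    have hq0 : 0 ≤ q := Finset.sum_nonneg fun i _ => sq_nonneg _
    have hxy' : ∑ i : Fin (n + 1), x i.succ * y i.succ = x 0 * y 0 := by linarith
    rw [hxy', mul_pow] at cs
    have hqpos : 0 < q := by
      refine hq0.lt_of_ne' fun h0 => hy ?_
      rw [h0, mul_zero] at cs
      have hx0 : 0 < x 0 ^ 2 := by linarith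
      have hy0 : y 0 ^ 2 = 0 := le_antisymm (by nlinarith) (sq_nonneg _)
      rw [hq, Finset.sum_eq_zero_iff_of_nonneg fun i _ => sq_nonneg _] at h0
      funext i
      refine Fin.cases ?_ (fun i => ?_) i
      · simpa using hy0
      · simpa using h0 i (Finset.mem_univ _)
    by_contra hcon
    have : q ≤ y 0 ^ 2 := by linarith
    nlinarith [mul_pos (show 0 < x 0 ^ 2 - p by linarith) hqpos,
      mul_le_mul_of_nonneg_left this (sq_nonneg (x 0))]

lemma minkSpacelike_pos {n : ℕ} {W : Submodule ℝ (Fin (n + 2) → ℝ)} (h : MinkSpacelike n W)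
    {w : Fin (n + 2) → ℝ} (hw : w ∈ W) (hw0 : w ≠ 0) : 0 < mink n w w := by
  by_contra hcon
  have hnn : ∀ x ∈ W, 0 ≤ minkForm n x x := fun x hx => by
    by_contra hx'
    exact h.1 ⟨x, hx, not_le.1 hx'⟩
  have hB := isLorentzian_minkForm n
  have hww : minkForm n w w = 0 := le_antisymm (not_lt.1 hcon) (hnn w hw)
  refine h.2 ⟨w, hw, hw0, fun x hx => ?_⟩
  rw [← minkForm_apply]
  by_contra hwx
  set b := minkForm n w x with hb
  have hxw : minkForm n x w = b := hB.symm _ _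
  obtain ⟨c, hc⟩ : ∃ c, c * b = -(minkForm n x x + 1) / 2 := ⟨_, div_mul_cancel₀ _ hwx⟩
  have := hnn (x + c • w) (W.add_mem hx (W.smul_mem _ hw))
  simp only [map_add, map_smul, LinearMap.add_apply, LinearMap.smul_apply, smul_eq_mul, hww, hxw,
    ← hb, hc] at this
  linarith

end Minkowski

end IsLorentzian

/-- Two `B`-skew-adjoint endomorphisms of Minkowski space `ℝ^{1,n+1}` are conjugate by a
linear isometry of the Minkowski form iff their squares have the same characteristic
polynomial and their kernels have the same causal type. -/
theorem stmt_14 (n : ℕ) (hn : 3 ≤ n)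
    (F F' : (Fin (n + 2) → ℝ) →ₗ[ℝ] (Fin (n + 2) → ℝ))
    (hSkew : ∀ u v, mink n (F u) v = - mink n u (F v))
    (hSkew' : ∀ u v, mink n (F' u) v = - mink n u (F' v)) :
    (∃ Λ : (Fin (n + 2) → ℝ) ≃ₗ[ℝ] (Fin (n + 2) → ℝ),
        (∀ u v, mink n (Λ u) (Λ v) = mink n u v) ∧
        F' = Λ.toLinearMap ∘ₗ F ∘ₗ Λ.symm.toLinearMap) ↔
      ((F ∘ₗ F).charpoly = (F' ∘ₗ F').charpoly ∧
        ((MinkTimelike n (LinearMap.ker F) ∧ MinkTimelike n (LinearMap.ker F')) ∨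
         (MinkNull n (LinearMap.ker F) ∧ MinkNull n (LinearMap.ker F')) ∨
         (MinkSpacelike n (LinearMap.ker F) ∧ MinkSpacelike n (LinearMap.ker F')))) := by
  constructor
  · rintro ⟨Λ, hΛ, rfl⟩
    have hF : ∀ u, (Λ.toLinearMap ∘ₗ F ∘ₗ Λ.symm.toLinearMap) (Λ u) = Λ (F u) := fun u => by simp
    have hker : ∀ u, Λ u ∈ LinearMap.ker (Λ.toLinearMap ∘ₗ F ∘ₗ Λ.symm.toLinearMap) ↔
        u ∈ LinearMap.ker F := fun u => by
      rw [LinearMap.mem_ker, LinearMap.mem_ker, hF, LinearEquiv.map_eq_zero_iff]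
    set F' := Λ.toLinearMap ∘ₗ F ∘ₗ Λ.symm.toLinearMap
    have hT : MinkTimelike n (LinearMap.ker F') ↔ MinkTimelike n (LinearMap.ker F) := by
      unfold MinkTimelike
      rw [Λ.surjective.exists]
      simp only [hker, hΛ]
    have hN : MinkNull n (LinearMap.ker F') ↔ MinkNull n (LinearMap.ker F) := by
      unfold MinkNull
      rw [Λ.surjective.exists]
      refine exists_congr fun u => ?_
      rw [hker, Λ.map_ne_zero_iff, Λ.surjective.forall]
      simp only [hker, hΛ]
    refine ⟨?_, ?_⟩
    · rw [← Λ.charpoly_conj (F ∘ₗ F)]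
      congr 1
      refine LinearMap.ext fun u => ?_
      obtain ⟨v, rfl⟩ := Λ.surjective u
      rw [LinearEquiv.conj_apply_apply, LinearMap.comp_apply, LinearMap.comp_apply, hF, hF,
        Λ.symm_apply_apply]
    · rw [MinkSpacelike, MinkSpacelike, hT, hN]
      tauto
  · rintro ⟨hchar, htype⟩
    have hB := IsLorentzian.isLorentzian_minkForm n
    suffices h : IsometricallyConj (IsLorentzian.minkForm n) F (IsLorentzian.minkForm n) F' by
      obtain ⟨Λ, hΛ, hΛF⟩ := h
      refine ⟨Λ, hΛ, LinearMap.ext fun u => ?_⟩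
      obtain ⟨v, rfl⟩ := Λ.surjective u
      simp [hΛF]
    rcases htype with ⟨⟨v, hv, hvv⟩, v', hv', hvv'⟩ | ⟨⟨k, hk, hk0, hkr⟩, k', hk', hk0', hkr'⟩ |
      ⟨hs, hs'⟩
    · exact hB.isometricallyConj_of_ker_neg hSkew hB hSkew' hchar hvv hv hvv' hv'
    · exact hB.isometricallyConj_of_ker_null hSkew hB hSkew' hchar hk0 hk hkr hk0' hk' hkr'
    · exact IsLorentzian.isometricallyConj_of_ker_pos _ rfl hB hB hSkew hSkew' hchar
        (fun v hv hv0 => IsLorentzian.minkSpacelike_pos hs hv hv0)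
        (fun v hv hv0 => IsLorentzian.minkSpacelike_pos hs' hv hv0)
end

section
/- Let λ > 0 and A₀, C₀, E₀ ∈ ℝ, and define P(χ) := C₀ − E₀²/χ² − 2A₀χ² − λχ⁴ for χ ≠ 0. Then the following are equivalent: (1) there exists a nonempty open interval I ⊆ ℝ with 0 ∉ I such that P(χ) > 0 for all χ ∈ I; (2) there exist real numbers a, b, c with a² > b² ≥ 0 such that χ²·P(χ) = −λ(χ² − a²)(χ² − b²)(χ² + c²) for all χ ∈ ℝ (both sides being polynomials in χ). -/
/-- A real cubic with negative leading coefficient that is nonpositive at `0` and positive at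
some `t > 0` has a root in `[0, t)` and a root in `(t, ∞)`. -/
lemma exists_cubic_roots_of_pos {l A C E t : ℝ} (hl : 0 < l) (ht : 0 < t)
    (hq : 0 < C * t - E ^ 2 - 2 * A * t ^ 2 - l * t ^ 3) :
    ∃ u v : ℝ, 0 ≤ v ∧ v < t ∧ t < u ∧
      C * v - E ^ 2 - 2 * A * v ^ 2 - l * v ^ 3 = 0 ∧
      C * u - E ^ 2 - 2 * A * u ^ 2 - l * u ^ 3 = 0 := by
  set q : ℝ → ℝ := fun s => C * s - E ^ 2 - 2 * A * s ^ 2 - l * s ^ 3 with hqdef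
  have hcont : Continuous q := by fun_prop
  have hqt : 0 < q t := hq
  have hq0 : q 0 ≤ 0 := by
    simp only [hqdef]
    nlinarith [sq_nonneg E]
  obtain ⟨v, ⟨hv0, hvt⟩, hv⟩ := intermediate_value_Icc ht.le hcont.continuousOn ⟨hq0, hqt.le⟩
  set T : ℝ := t + 1 + (|C| + 2 * |A|) / l with hT
  have hK : 0 ≤ (|C| + 2 * |A|) / l := by positivity
  have hT1 : 1 ≤ T := by linarith
  have hlT : |C| + 2 * |A| ≤ l * T := by
    have : l * T = l * (t + 1) + (|C| + 2 * |A|) := by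
      rw [hT]
      field_simp
    nlinarith
  have hqT : q T ≤ 0 := by
    have h1 : C * T ≤ |C| * T ^ 2 :=
      calc C * T ≤ |C| * T := by gcongr; exact le_abs_self C
        _ ≤ |C| * T ^ 2 := by gcongr; nlinarith
    have h2 : -A * T ^ 2 ≤ |A| * T ^ 2 := by
      gcongr
      exact neg_le_abs A
    have h3 : (|C| + 2 * |A|) * T ^ 2 ≤ l * T * T ^ 2 := by gcongr
    simp only [hqdef]
    nlinarith [sq_nonneg E]
  obtain ⟨u, ⟨htu, -⟩, hu⟩ :=
    intermediate_value_Icc' (by linarith : t ≤ T) hcont.continuousOn ⟨hqT, hqt.le⟩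
  refine ⟨u, v, hv0, lt_of_le_of_ne hvt ?_, lt_of_le_of_ne htu ?_, hv, hu⟩
  · rintro rfl
    exact hqt.ne' hv
  · rintro rfl
    exact hqt.ne' hu

/-- A cubic with two distinct roots `u`, `v` and nonzero leading coefficient splits. -/
lemma exists_cubic_factorization {l A C D u v : ℝ} (hl : l ≠ 0) (huv : u ≠ v)
    (hv : C * v - D - 2 * A * v ^ 2 - l * v ^ 3 = 0)
    (hu : C * u - D - 2 * A * u ^ 2 - l * u ^ 3 = 0) :
    ∃ r : ℝ, ∀ s : ℝ,
      C * s - D - 2 * A * s ^ 2 - l * s ^ 3 = -l * (s - u) * (s - v) * (s - r) := by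
  obtain ⟨r, hr⟩ : ∃ r : ℝ, 2 * A = -l * (u + v + r) :=
    ⟨-(2 * A / l) - u - v, by field_simp; ring⟩
  have hC : C = -l * (u * v + r * (u + v)) := by
    apply mul_left_cancel₀ (sub_ne_zero.mpr huv)
    linear_combination hu - hv + (u ^ 2 - v ^ 2) * hr
  have hD : D = -l * (u * v * r) := by
    linear_combination -hu + u * hC - u ^ 2 * hr
  refine ⟨r, fun s => ?_⟩
  linear_combination s * hC - hD - s ^ 2 * hr

/-- The function `P(χ) = C₀ − E₀²/χ² − 2A₀χ² − λχ⁴` (with `λ > 0`) is positive on some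
nonempty open interval avoiding `0` if and only if the even polynomial `χ²·P(χ)` factors
as `−λ(χ² − a²)(χ² − b²)(χ² + c²)` with `a² > b² ≥ 0`. -/
theorem stmt_15 (lam A₀ C₀ E₀ : ℝ) (hlam : 0 < lam)
    (P : ℝ → ℝ)
    (hP : ∀ χ : ℝ, P χ = C₀ - E₀ ^ 2 / χ ^ 2 - 2 * A₀ * χ ^ 2 - lam * χ ^ 4) :
    (∃ x y : ℝ, x < y ∧ (0 : ℝ) ∉ Set.Ioo x y ∧ ∀ χ ∈ Set.Ioo x y, 0 < P χ) ↔
    (∃ a b c : ℝ, b ^ 2 < a ^ 2 ∧ 0 ≤ b ^ 2 ∧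
      ∀ χ : ℝ, χ ≠ 0 →
        χ ^ 2 * P χ = -lam * (χ ^ 2 - a ^ 2) * (χ ^ 2 - b ^ 2) * (χ ^ 2 + c ^ 2)) := by
  have hmul : ∀ χ : ℝ, χ ≠ 0 → χ ^ 2 * P χ =
      C₀ * χ ^ 2 - E₀ ^ 2 - 2 * A₀ * (χ ^ 2) ^ 2 - lam * (χ ^ 2) ^ 3 := by
    intro χ hχ
    rw [hP]
    field_simp
  constructor
  · rintro ⟨x, y, hxy, h0, hpos⟩
    obtain ⟨z, hz⟩ := Set.nonempty_Ioo.mpr hxy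
    have hz0 : z ≠ 0 := fun h => h0 (h ▸ hz)
    have ht : 0 < z ^ 2 := by positivity
    have hq := mul_pos ht (hpos z hz)
    rw [hmul z hz0] at hq
    obtain ⟨u, v, hv0, hvt, htu, hv, hu⟩ := exists_cubic_roots_of_pos hlam ht hq
    obtain ⟨r, hr⟩ := exists_cubic_factorization hlam.ne' (hvt.trans htu).ne' hv hu
    have hu0 : 0 < u := ht.trans htu
    rcases le_or_gt r 0 with hr0 | hr0
    · refine ⟨√u, √v, √(-r), ?_, sq_nonneg _, fun χ hχ => ?_⟩
      · rw [Real.sq_sqrt hu0.le, Real.sq_sqrt hv0]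
        exact hvt.trans htu
      · rw [hmul χ hχ, hr, Real.sq_sqrt hu0.le, Real.sq_sqrt hv0,
          Real.sq_sqrt (neg_nonneg.mpr hr0)]
        ring
    · have hv' : v = 0 := by
        by_contra hne
        have hvpos : 0 < v := lt_of_le_of_ne hv0 (Ne.symm hne)
        have h := hr 0
        have : 0 < lam * u * v * r := by positivity
        nlinarith [sq_nonneg E₀]
      have hru : r < u := by
        by_contra! hle
        rw [hr, hv'] at hq
        have : 0 ≤ lam * (u - z ^ 2) * z ^ 2 * (r - z ^ 2) :=
          mul_nonneg (mul_nonneg (mul_nonneg hlam.le (by linarith)) ht.le) (by linarith)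
        linarith
      refine ⟨√u, √r, 0, ?_, sq_nonneg _, fun χ hχ => ?_⟩
      · rwa [Real.sq_sqrt hu0.le, Real.sq_sqrt hr0.le]
      · rw [hmul χ hχ, hr, hv', Real.sq_sqrt hu0.le, Real.sq_sqrt hr0.le]
        ring
  · rintro ⟨a, b, c, hab, -, h⟩
    refine ⟨|b|, |a|, sq_lt_sq.mp hab, fun h0 => (abs_nonneg b).not_gt h0.1, ?_⟩
    rintro χ ⟨hb, ha⟩
    have hχ : 0 < χ := (abs_nonneg b).trans_lt hb
    have hb2 : 0 < χ ^ 2 - b ^ 2 := sub_pos.mpr (sq_lt_sq.mpr (by rwa [abs_of_pos hχ]))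
    have ha2 : 0 < a ^ 2 - χ ^ 2 := sub_pos.mpr (sq_lt_sq.mpr (by rwa [abs_of_pos hχ]))
    have hprod : 0 < lam * (a ^ 2 - χ ^ 2) * (χ ^ 2 - b ^ 2) * (χ ^ 2 + c ^ 2) := by positivity
    refine pos_of_mul_pos_right (a := χ ^ 2) ?_ (sq_nonneg χ)
    rw [h χ hχ.ne']
    linarith
end
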